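/- Let G be a finite group and 𝒫 a set of real-valued characters of G satisfying: (1) τ + τ̄ ∈ 𝒫 for every character τ of G of degree 0; (2) Ind_H^G(τ − 1_H − det τ) ∈ 𝒫 for every subgroup H ≤ G and every degree-2 character τ of H that factors through a quotient of H isomorphic to C₂×C₂, D₈, or the dihedral group D_{2p} of order 2p for an odd prime p; (3) if τ_i ∈ 𝒫 and n_i ∈ ℤ then Σ_i n_i τ_i ∈ 𝒫. Then 𝒫 contains every permutation character of G of degree 0 with trivial determinant. -/

import Mathlib

open scoped BigOperators

noncomputable section

namespace Chars

/-- The permutation character `Ind_H^G 1` of `G` acting on the cosets `G ⧸ H`: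
`g` is sent to the number of fixed points of `g` on `G ⧸ H`. -/
def permChar {G : Type} [Group G] (H : Subgroup G) : G → ℂ :=
  fun g => (Nat.card {x : G ⧸ H // g • x = x} : ℂ)

open scoped Classical in
/-- The class function on `G` induced from a class function `f` on a subgroup `H`. -/
def indChar {G : Type} [Group G] [Finite G] (H : Subgroup G) (f : ↥H → ℂ) : G → ℂ :=
  fun g => (Nat.card ↥H : ℂ)⁻¹ *
    ∑ᶠ x : G, if h : x⁻¹ * g * x ∈ H then f ⟨x⁻¹ * g * x, h⟩ else 0

/-- The determinant character of a finite dimensional complex representation. -/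
def detChar {G : Type} [Group G] (V : FDRep ℂ G) : G → ℂ :=
  fun g => LinearMap.det (V.ρ g)

/-- `χ` is a permutation (virtual) character: a `ℤ`-linear combination of the
characters `Ind_H^G 1` of permutation representations. -/
def IsPermChar {G : Type} [Group G] (χ : G → ℂ) : Prop :=
  ∃ (k : ℕ) (Hs : Fin k → Subgroup G) (ns : Fin k → ℤ),
    χ = fun g => ∑ i, (ns i : ℂ) * permChar (Hs i) g

/-- `χ` is a virtual character: a difference of two genuine characters. -/
def IsVirtualChar {G : Type} [Group G] (χ : G → ℂ) : Prop :=
  ∃ V W : FDRep ℂ G, χ = V.character - W.character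

/-- The virtual character `χ` has trivial determinant:  writing `χ = χ_V - χ_W`, the
determinant characters of `V` and `W` agree.  (The determinant of a virtual character
is well defined, so this does not depend on the choice of decomposition.) -/
def HasTrivialDet {G : Type} [Group G] (χ : G → ℂ) : Prop :=
  ∃ V W : FDRep ℂ G, χ = V.character - W.character ∧ ∀ g, detChar V g = detChar W g

/-- The set `S_G` of permutation characters of `G` of degree `0` with trivial
determinant. -/
def MemS {G : Type} [Group G] (χ : G → ℂ) : Prop :=
  IsPermChar χ ∧ χ 1 = 0 ∧ HasTrivialDet χ

/-- The set `P_G`: the smallest set of (real valued) characters of `G` containing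
`τ + τ̄` for every virtual character `τ` of degree `0`, containing
`Ind_H^G (τ - 1 - det τ)` for every subgroup `H ≤ G` and every degree `2` character
`τ` of `H` factoring through a quotient of `H` isomorphic to `C₂ × C₂`, `D₈` or
`D_{2p}` (`p` an odd prime), and closed under `ℤ`-linear combinations. -/
inductive MemP (G : Type) [Group G] [Finite G] : (G → ℂ) → Prop where
  | selfConj (V W : FDRep ℂ G) (hdeg : V.character 1 = W.character 1) :
      MemP G ((V.character - W.character) + star (V.character - W.character))
  | dihedralInd (H : Subgroup G) (τ : FDRep ℂ ↥H) (hdeg : τ.character 1 = 2)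
      (N : Subgroup ↥H) [hN : N.Normal]
      (hfac : ∀ n h : ↥H, n ∈ N → τ.character (n * h) = τ.character h)
      (hquot : Nonempty (↥H ⧸ N ≃* Multiplicative (ZMod 2) × Multiplicative (ZMod 2)) ∨
               Nonempty (↥H ⧸ N ≃* DihedralGroup 4) ∨
               ∃ p : ℕ, p.Prime ∧ Odd p ∧ Nonempty (↥H ⧸ N ≃* DihedralGroup p)) :
      MemP G (indChar H (τ.character - 1 - detChar τ))
  | zero : MemP G 0
  | add {χ ψ : G → ℂ} : MemP G χ → MemP G ψ → MemP G (χ + ψ)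
  | zsmul (n : ℤ) {χ : G → ℂ} : MemP G χ → MemP G (n • χ)

end Chars
open Chars

section

set_option linter.unusedSectionVars false

open scoped Classical

namespace PermInd

section

theorem exists_eigenvalues {V : Type*} [AddCommGroup V] [Module ℂ V] [FiniteDimensional ℂ V]
    (A : V →ₗ[ℂ] V) {N : ℕ} (hN : 0 < N) (hA : A ^ N = 1) :
    ∃ (n : ℕ) (d : Fin n → ℂ), (∀ i, d i ^ N = 1) ∧ (∀ k, LinearMap.trace ℂ V (A ^ k) = ∑ i, d i ^ k)
      ∧ LinearMap.det A = ∏ i, d i := by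
  have hss : Module.End.IsSemisimple A := by
    refine Module.End.isSemisimple_of_squarefree_aeval_eq_zero
      (p := Polynomial.X ^ N - Polynomial.C 1) ?_ ?_
    · exact (Polynomial.separable_X_pow_sub_C (1 : ℂ) (by exact_mod_cast hN.ne') one_ne_zero).squarefree
    · simp [hA]
  have htop := hss.iSup_eigenspace_eq_top
  let s : Set V := {v | ∃ μ : ℂ, A v = μ • v}
  have hs : ⊤ ≤ Submodule.span ℂ s := by
    rw [← htop, iSup_le_iff]
    intro μ v hv
    exact Submodule.subset_span ⟨μ, Module.End.mem_eigenspace_iff.1 hv⟩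
  let b₀ := Module.Basis.ofSpan hs
  have : Fintype _ := FiniteDimensional.fintypeBasisIndex b₀
  let b := b₀.reindex (Fintype.equivFin _)
  have hb : ∀ i, ∃ μ : ℂ, A (b i) = μ • b i := by
    intro i
    simp only [b, Module.Basis.reindex_apply]
    exact Module.Basis.ofSpan_subset hs ⟨_, rfl⟩
  choose d hd using hb
  have hdiag : LinearMap.toMatrix b b A = Matrix.diagonal d := by
    ext i j
    rw [LinearMap.toMatrix_apply, hd, map_smul, Module.Basis.repr_self]
    rw [Finsupp.smul_apply, Finsupp.single_apply, Matrix.diagonal_apply]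
    split_ifs with h h' h' <;> simp_all
  have hpow : ∀ k, LinearMap.toMatrix b b (A ^ k) = Matrix.diagonal (d ^ k) := by
    intro k
    rw [← LinearMap.toMatrix_pow, hdiag, Matrix.diagonal_pow]
  refine ⟨_, d, fun i => ?_, fun k => ?_, ?_⟩
  · have h := hpow N
    rw [hA, LinearMap.toMatrix_one] at h
    have := congrFun (congrFun h i) i
    simpa using this.symm
  · rw [LinearMap.trace_eq_matrix_trace ℂ b, hpow, Matrix.trace_diagonal]
    rfl
  · rw [← LinearMap.det_toMatrix b, hdiag, Matrix.det_diagonal]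

theorem sum_pow_root {N : ℕ} (hN : 0 < N) {w d : ℂ} (hw : w ^ N = 1) (hd : d ^ N = 1) :
    ∑ j ∈ Finset.range N, w⁻¹ ^ j * d ^ j = if d = w then (N : ℂ) else 0 := by
  have hw0 : w ≠ 0 := by rintro rfl; simp [hN.ne'] at hw
  simp only [← mul_pow]
  split_ifs with h
  · rw [h, inv_mul_cancel₀ hw0]; simp
  · have h1 : w⁻¹ * d ≠ 1 := fun h' => h ((inv_mul_eq_one₀ hw0).1 h').symm
    rw [geom_sum_eq h1, mul_pow, inv_pow, hw, hd]
    simp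

theorem even_of_prod_eq {N n m : ℕ} (hN : 0 < N) (hN2 : Even N) (d : Fin n → ℂ) (e : Fin m → ℂ)
    (hd : ∀ i, d i ^ N = 1) (he : ∀ i, e i ^ N = 1) (hprod : ∏ i, d i = ∏ i, e i)
    (hreal : ∀ k, star (∑ i, d i ^ k - ∑ i, e i ^ k) = ∑ i, d i ^ k - ∑ i, e i ^ k) :
    ∃ k : ℤ, ∑ j ∈ Finset.range N, (-1) ^ j * (∑ i, d i ^ j - ∑ i, e i ^ j) = N * (2 * k) := by
  let c : ℂ → ℤ := fun w =>
    (Finset.univ.filter (d · = w)).card - (Finset.univ.filter (e · = w)).card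
  have hN0 : (N : ℂ) ≠ 0 := by exact_mod_cast hN.ne'
  have hc : ∀ w, w ^ N = 1 →
      ∑ j ∈ Finset.range N, w⁻¹ ^ j * (∑ i, d i ^ j - ∑ i, e i ^ j) = N * c w := by
    intro w hw
    simp only [mul_sub, Finset.mul_sum, Finset.sum_sub_distrib]
    rw [Finset.sum_comm, Finset.sum_congr rfl fun i _ => sum_pow_root hN hw (hd i),
      Finset.sum_comm (s := Finset.range N), Finset.sum_congr rfl fun i _ => sum_pow_root hN hw (he i)]
    simp only [← Finset.sum_filter, Finset.sum_const, nsmul_eq_mul, c]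
    push_cast
    ring
  have hcs : ∀ w, w ^ N = 1 → c (star w) = c w := by
    intro w hw
    have hw' : (star w) ^ N = 1 := by rw [← star_pow, hw, star_one]
    have h := congrArg star (hc w hw)
    simp only [star_sum, star_mul', star_pow, star_inv₀, hreal, star_natCast, hc _ hw',
      star_intCast] at h
    exact_mod_cast mul_left_cancel₀ hN0 h
  have hneg : (-1 : ℂ) ^ N = 1 := hN2.neg_one_pow
  have hne : Even (c (-1)) := by
    let S : Finset ℂ := (Polynomial.nthRoots N (1 : ℂ)).toFinset
    have hS : ∀ w, w ∈ S ↔ w ^ N = 1 := fun w => by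
      simp [S, Polynomial.mem_nthRoots hN]
    have hS0 : ∀ w ∈ S, w ≠ 0 := by
      rintro w hw rfl
      rw [hS] at hw
      simp [hN.ne'] at hw
    have hp : ∏ w ∈ S, w ^ c w = 1 := by
      have h1 : ∏ i, d i = ∏ w ∈ S, w ^ (Finset.univ.filter (d · = w)).card := by
        rw [← Finset.prod_fiberwise_of_maps_to (g := d) (t := S) fun i _ => (hS _).2 (hd i)]
        refine Finset.prod_congr rfl fun w _ => ?_
        rw [Finset.prod_congr rfl fun i hi => (Finset.mem_filter.1 hi).2, Finset.prod_const]
      have h2 : ∏ i, e i = ∏ w ∈ S, w ^ (Finset.univ.filter (e · = w)).card := by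
        rw [← Finset.prod_fiberwise_of_maps_to (g := e) (t := S) fun i _ => (hS _).2 (he i)]
        refine Finset.prod_congr rfl fun w _ => ?_
        rw [Finset.prod_congr rfl fun i hi => (Finset.mem_filter.1 hi).2, Finset.prod_const]
      rw [Finset.prod_congr rfl fun w hw => zpow_sub₀ (hS0 w hw) _ _]
      simp only [zpow_natCast]
      rw [Finset.prod_div_distrib, ← h1, ← h2, hprod, div_self]
      rw [h2]
      exact Finset.prod_ne_zero_iff.2 fun w hw => pow_ne_zero _ (hS0 w hw)
    have hnorm : ∀ w ∈ S, star w * w = 1 := by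
      intro w hw
      have := Complex.norm_eq_one_of_pow_eq_one ((hS w).1 hw) hN.ne'
      have h2 := Complex.conj_mul' w
      rw [this] at h2
      simpa using h2
    rw [← Finset.mul_prod_erase S _ ((hS (-1)).2 hneg),
      Finset.prod_involution (s := S.erase (-1)) (fun w _ => star w), mul_one] at hp
    · by_contra h
      rw [Int.not_even_iff_odd] at h
      rw [h.neg_one_zpow] at hp
      norm_num at hp
    · intro w hw
      have hw := Finset.mem_of_mem_erase hw
      rw [hcs w ((hS w).1 hw), ← mul_zpow, mul_comm, hnorm w hw, one_zpow]
    · intro w hw h1 h2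
      obtain ⟨h3, hw⟩ := Finset.mem_erase.1 hw
      have h4 := hnorm w hw
      rw [h2] at h4
      rcases mul_self_eq_one_iff.1 h4 with rfl | rfl
      · simp at h1
      · exact h3 rfl
    · intro w hw
      obtain ⟨h3, hw⟩ := Finset.mem_erase.1 hw
      refine Finset.mem_erase.2 ⟨fun h => h3 ?_, ?_⟩
      · rw [← star_star w, h]; simp
      · rw [hS, ← star_pow, (hS w).1 hw, star_one]
    · intro w _
      exact star_star w
  obtain ⟨k, hk⟩ := hne
  refine ⟨k, ?_⟩
  have := hc (-1) hneg
  rw [hk] at this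
  have h1 : (-1 : ℂ)⁻¹ = -1 := by norm_num
  rw [h1] at this
  rw [this]
  push_cast
  ring

variable {G : Type} [Group G]

theorem even_of_detChar_eq (V W : FDRep ℂ G) (hdet : ∀ g, detChar V g = detChar W g)
    (hreal : ∀ g, star ((V.character - W.character) g) = (V.character - W.character) g)
    (g : G) {N : ℕ} (hN : 0 < N) (hN2 : Even N) (hg : g ^ N = 1) :
    ∃ k : ℤ, ∑ j ∈ Finset.range N, (-1) ^ j * (V.character - W.character) (g ^ j)
      = N * (2 * k) := by
  obtain ⟨n, d, hd, hdt, hdd⟩ := exists_eigenvalues (V.ρ g) hN (by rw [← map_pow, hg, map_one])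
  obtain ⟨m, e, he, het, hed⟩ := exists_eigenvalues (W.ρ g) hN (by rw [← map_pow, hg, map_one])
  have hc : ∀ k, (V.character - W.character) (g ^ k) = ∑ i, d i ^ k - ∑ i, e i ^ k := by
    intro k
    rw [← hdt, ← het, ← map_pow, ← map_pow]
    rfl
  have := even_of_prod_eq hN hN2 d e hd he (by rw [← hdd, ← hed]; exact hdet g)
    (fun k => by rw [← hc, hreal])
  simpa only [hc] using this

end

variable {G : Type} [Group G] [Fintype G]

/-- Extension by zero to `G` of a function on a subgroup `K`. -/
def extend (K : Subgroup G) (φ : K → ℂ) : G → ℂ :=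
  fun g => if h : g ∈ K then φ ⟨g, h⟩ else 0

theorem extend_mem {K : Subgroup G} (φ : K → ℂ) {g : G} (h : g ∈ K) :
    extend K φ g = φ ⟨g, h⟩ := dif_pos h

theorem extend_not_mem {K : Subgroup G} (φ : K → ℂ) {g : G} (h : g ∉ K) :
    extend K φ g = 0 := dif_neg h

/-- Induction of class functions from `K` to `L`, where functions on a subgroup are regarded
as functions on `G` that vanish outside of it. -/
def ind (K L : Subgroup G) : (G → ℂ) →ₗ[ℂ] (G → ℂ) where
  toFun f := fun g => (Nat.card K : ℂ)⁻¹ * ∑ x : L, f ((x : G)⁻¹ * g * x)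
  map_add' f₁ f₂ := by
    ext g; simp [Finset.sum_add_distrib, mul_add]
  map_smul' c f := by
    ext g; simp [← Finset.mul_sum, mul_left_comm]

theorem ind_apply (K L : Subgroup G) (f : G → ℂ) (g : G) :
    ind K L f g = (Nat.card K : ℂ)⁻¹ * ∑ x : L, f ((x : G)⁻¹ * g * x) := rfl

theorem card_ne_zero (K : Subgroup G) : (Nat.card K : ℂ) ≠ 0 := by
  simp [Nat.card_eq_fintype_card]

theorem ind_ind (K : Subgroup G) {L M : Subgroup G} (h : L ≤ M) (f : G → ℂ) :
    ind L M (ind K L f) = ind K M f := by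
  ext g
  simp only [ind_apply]
  rw [← Finset.mul_sum, Finset.sum_comm, ← mul_assoc, mul_comm _ (Nat.card K : ℂ)⁻¹, mul_assoc]
  congr 1
  have : ∀ y : L, ∑ x : M, f ((y : G)⁻¹ * ((x : G)⁻¹ * g * x) * y)
      = ∑ x : M, f ((x : G)⁻¹ * g * x) := by
    intro y
    refine Fintype.sum_equiv (Equiv.mulRight (⟨y, h y.2⟩ : M)) _ _ fun x => ?_
    simp [mul_assoc]
  rw [Finset.sum_congr rfl fun y _ => this y]
  simp only [Finset.sum_const, Finset.card_univ, nsmul_eq_mul, ← Nat.card_eq_fintype_card]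
  rw [← mul_assoc, inv_mul_cancel₀ (card_ne_zero L), one_mul]

theorem ind_not_mem {K L : Subgroup G} (h : K ≤ L) {f : G → ℂ} (hf : ∀ g ∉ K, f g = 0) {g : G}
    (hg : g ∉ L) : ind K L f g = 0 := by
  rw [ind_apply, Finset.sum_eq_zero, mul_zero]
  intro x _
  refine hf _ fun hx => hg ?_
  have := L.mul_mem (L.mul_mem x.2 (h hx)) (L.inv_mem x.2)
  simpa [mul_assoc] using this

theorem ind_conj (K L : Subgroup G) (f : G → ℂ) {x : G} (hx : x ∈ L) (g : G) :
    ind K L f (x⁻¹ * g * x) = ind K L f g := by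
  simp only [ind_apply]
  congr 1
  refine Fintype.sum_equiv (Equiv.mulLeft (⟨x, hx⟩ : L)) _ _ fun y => ?_
  simp [mul_assoc]

theorem ind_mul (K L : Subgroup G) (f : G → ℂ) {F : G → ℂ}
    (hF : ∀ x ∈ L, ∀ g, F (x⁻¹ * g * x) = F g) : ind K L (f * F) = ind K L f * F := by
  ext g
  simp only [ind_apply, Pi.mul_apply]
  rw [Finset.sum_congr rfl fun x _ => by rw [hF x x.2 g], ← Finset.sum_mul, mul_assoc]

theorem ind_self (K : Subgroup G) {f : G → ℂ}
    (hf : ∀ x ∈ K, ∀ g, f (x⁻¹ * g * x) = f g) : ind K K f = f := by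
  ext g
  rw [ind_apply, Finset.sum_congr rfl fun (x : K) _ => hf x x.2 g]
  simp only [Finset.sum_const, Finset.card_univ, nsmul_eq_mul, ← Nat.card_eq_fintype_card]
  rw [← mul_assoc, inv_mul_cancel₀ (card_ne_zero K), one_mul]

theorem extend_conj {K : Subgroup G} {φ : K → ℂ} (hφ : ∀ x y : K, φ (x⁻¹ * y * x) = φ y)
    {x : G} (hx : x ∈ K) (g : G) : extend K φ (x⁻¹ * g * x) = extend K φ g := by
  by_cases hg : g ∈ K
  · have h' : x⁻¹ * g * x ∈ K := K.mul_mem (K.mul_mem (K.inv_mem hx) hg) hx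
    rw [extend_mem _ hg, extend_mem _ h']
    exact hφ ⟨x, hx⟩ ⟨g, hg⟩
  · rw [extend_not_mem _ hg, extend_not_mem]
    intro h'
    refine hg ?_
    have := K.mul_mem (K.mul_mem hx h') (K.inv_mem hx)
    simpa [mul_assoc] using this

/-- The indicator function of a subgroup. -/
def one (K : Subgroup G) : G → ℂ := extend K fun _ => 1

theorem one_apply (K : Subgroup G) (g : G) : one K g = if g ∈ K then 1 else 0 := by
  unfold one extend; split_ifs <;> rfl

theorem one_conj {K : Subgroup G} {x : G} (hx : x ∈ K) (g : G) :
    one K (x⁻¹ * g * x) = one K g := extend_conj (fun _ _ => rfl) hx g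

/-- The permutation character of `L` acting on the cosets of `K`. -/
def perm (K L : Subgroup G) : G → ℂ := ind K L (one K)

theorem perm_self (K : Subgroup G) : perm K K = one K := ind_self K fun _ hx g => one_conj hx g

theorem ind_perm (K : Subgroup G) {L M : Subgroup G} (h : L ≤ M) :
    ind L M (perm K L) = perm K M := ind_ind K h _

theorem ind_one (K L : Subgroup G) : ind K L (one K) = perm K L := rfl

/-- The character of a two-dimensional representation of a dihedral group, minus the trivial
character and minus the determinant. -/
def dih {n : ℕ} (ψ : AddChar (ZMod n) ℂ) : DihedralGroup n → ℂ
  | .r i => ψ i + ψ (-i) - 2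
  | .sr _ => 0

theorem dih_conj {n : ℕ} (ψ : AddChar (ZMod n) ℂ) (x y : DihedralGroup n) :
    dih ψ (x⁻¹ * y * x) = dih ψ y := by
  rcases x with i | i <;> rcases y with j | j <;> simp [dih, add_comm]

/-- The functions on `L` from which the set of characters under study is induced. -/
inductive IsGen (L : Subgroup G) : (G → ℂ) → Prop
  | linear (φ : L →* ℂ) : IsGen L (extend L fun x => φ x + φ x⁻¹ - 2)
  | dihedral (n : ℕ) (hn : n = 2 ∨ n = 4 ∨ n.Prime ∧ Odd n) (Ψ : L →* DihedralGroup n)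
      (hΨ : Function.Surjective Ψ) (ψ : AddChar (ZMod n) ℂ) :
      IsGen L (extend L fun x => dih ψ (Ψ x))

/-- The group generated by the functions induced to `H` from the generating functions on
subgroups of `H`. -/
def genSpan (H : Subgroup G) : AddSubgroup (G → ℂ) :=
  AddSubgroup.closure {F | ∃ L ≤ H, ∃ f, IsGen L f ∧ F = ind L H f}

theorem IsGen.conj {L : Subgroup G} {f : G → ℂ} (hf : IsGen L f) {x : G} (hx : x ∈ L) (g : G) :
    f (x⁻¹ * g * x) = f g := by
  cases hf with
  | linear φ =>
    refine extend_conj (fun x y => ?_) hx g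
    have h : ∀ z : L, φ (x⁻¹ * z * x) = φ z := fun z => by
      rw [map_mul, mul_comm, ← map_mul]; simp
    have := h y⁻¹
    simp only [h y, ← this]; simp [mul_assoc]
  | dihedral n hn Ψ hΨ ψ =>
    refine extend_conj (fun x y => ?_) hx g
    simp only [map_mul, map_inv, dih_conj]

theorem IsGen.not_mem {L : Subgroup G} {f : G → ℂ} (hf : IsGen L f) {g : G} (hg : g ∉ L) :
    f g = 0 := by
  cases hf <;> exact extend_not_mem _ hg

theorem IsGen.mem_genSpan {L H : Subgroup G} (h : L ≤ H) {f : G → ℂ} (hf : IsGen L f) :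
    ind L H f ∈ genSpan H := AddSubgroup.subset_closure ⟨L, h, f, hf, rfl⟩

theorem IsGen.mem_genSpan_self {H : Subgroup G} {f : G → ℂ} (hf : IsGen H f) :
    f ∈ genSpan H := by
  have := hf.mem_genSpan le_rfl
  rwa [ind_self H fun x hx g => hf.conj hx g] at this

theorem ind_mem_genSpan {H M : Subgroup G} (h : H ≤ M) {f : G → ℂ} (hf : f ∈ genSpan H) :
    ind H M f ∈ genSpan M := by
  induction hf using AddSubgroup.closure_induction with
  | mem f hf =>
    obtain ⟨L, hL, f, hf, rfl⟩ := hf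
    rw [ind_ind L h]
    exact hf.mem_genSpan (hL.trans h)
  | zero => simp [zero_mem]
  | add f g _ _ hf hg => rw [map_add]; exact add_mem hf hg
  | neg f _ hf => rw [map_neg]; exact neg_mem hf

theorem ind_top (K : Subgroup G) (f : G → ℂ) (g : G) :
    ind K ⊤ f g = (Nat.card K : ℂ)⁻¹ * ∑ x : G, f (x⁻¹ * g * x) := by
  rw [ind_apply]
  congr 1
  exact Fintype.sum_equiv Subgroup.topEquiv.toEquiv _ _ fun _ => rfl

theorem indChar_eq (L : Subgroup G) (f : L → ℂ) : indChar L f = ind L ⊤ (extend L f) := by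
  ext g
  rw [ind_top, indChar, finsum_eq_sum_of_fintype]
  rfl

theorem permChar_eq (K : Subgroup G) : permChar K = perm K ⊤ := by
  ext g
  rw [perm, ind_top, permChar, Nat.card_eq_fintype_card, Fintype.card_subtype,
    Finset.card_filter, Nat.cast_sum]
  have h1 : ∀ x : G, one K (x⁻¹ * g * x) = if g • (x : G ⧸ K) = (x : G ⧸ K) then 1 else 0 := by
    intro x
    rw [one_apply]
    refine if_congr ?_ rfl rfl
    rw [MulAction.Quotient.smul_coe, eq_comm, QuotientGroup.eq, smul_eq_mul, mul_assoc]
  rw [Finset.sum_congr rfl fun x _ => h1 x,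
    ← Fintype.sum_equiv (Subgroup.groupEquivQuotientProdSubgroup (s := K)).symm
      (fun p : (G ⧸ K) × K => if g • p.1 = p.1 then (1 : ℂ) else 0) _ ?_]
  · rw [Fintype.sum_prod_type]
    have h2 : ∀ x : G ⧸ K, ∑ _y : K, (if g • x = x then (1 : ℂ) else 0)
        = Nat.card K * (if g • x = x then (1 : ℂ) else 0) := fun x => by
      rw [Finset.sum_const, Finset.card_univ, nsmul_eq_mul, ← Nat.card_eq_fintype_card]
    rw [Finset.sum_congr rfl fun x _ => h2 x, ← Finset.mul_sum, ← mul_assoc,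
      inv_mul_cancel₀ (card_ne_zero K), one_mul]
    push_cast
    rfl
  · rintro p
    have : ((Subgroup.groupEquivQuotientProdSubgroup (s := K)).symm p : G ⧸ K) = p.1 := by
      have h2 : (Subgroup.groupEquivQuotientProdSubgroup (s := K)
        ((Subgroup.groupEquivQuotientProdSubgroup (s := K)).symm p)).1 = p.1 := by simp
      rw [← h2]; rfl
    rw [this]

/-- The projector of the space of functions on `G` onto the functions that transform under right
translation by `L` according to `φ⁻¹`. -/
def proj (L : Subgroup G) (φ : L →* ℂ) : (G → ℂ) →ₗ[ℂ] (G → ℂ) :=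
  (Nat.card L : ℂ)⁻¹ • ∑ h : L, φ h • LinearMap.funLeft ℂ ℂ fun x => x * (h : G)

theorem proj_apply (L : Subgroup G) (φ : L →* ℂ) (f : G → ℂ) (x : G) :
    proj L φ f x = (Nat.card L : ℂ)⁻¹ * ∑ h : L, φ h * f (x * h) := by
  simp [proj, LinearMap.funLeft]

theorem proj_proj (L : Subgroup G) (φ : L →* ℂ) (f : G → ℂ) :
    proj L φ (proj L φ f) = proj L φ f := by
  ext x
  rw [proj_apply]
  have : ∀ h : L, φ h * proj L φ f (x * h) = proj L φ f x := by
    intro h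
    rw [proj_apply, proj_apply, mul_left_comm, Finset.mul_sum]
    congr 1
    refine Fintype.sum_equiv (Equiv.mulLeft h) _ _ fun k => ?_
    simp [mul_assoc]
  rw [Finset.sum_congr rfl fun h _ => this h]
  simp only [Finset.sum_const, Finset.card_univ, nsmul_eq_mul, ← Nat.card_eq_fintype_card]
  rw [← mul_assoc, inv_mul_cancel₀ (card_ne_zero L), one_mul]

/-- Left translation of functions on `G`. -/
def transl (g : G) : (G → ℂ) →ₗ[ℂ] (G → ℂ) := LinearMap.funLeft ℂ ℂ fun x => g⁻¹ * x

theorem transl_proj (L : Subgroup G) (φ : L →* ℂ) (g : G) (f : G → ℂ) :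
    transl g (proj L φ f) = proj L φ (transl g f) := by
  ext x
  simp [transl, LinearMap.funLeft, proj_apply, mul_assoc]

/-- The representation induced from the linear character `φ` of `L`. -/
def monomial (L : Subgroup G) (φ : L →* ℂ) : Representation ℂ G (LinearMap.range (proj L φ)) where
  toFun g := (proj L φ).rangeRestrict ∘ₗ transl g ∘ₗ (LinearMap.range (proj L φ)).subtype
  map_one' := by
    ext ⟨_, f, rfl⟩ x
    simp only [LinearMap.comp_apply, LinearMap.codRestrict_apply, LinearMap.rangeRestrict,
      Submodule.subtype_apply, transl_proj, proj_proj]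
    simp [transl, LinearMap.funLeft, Function.comp_def]
  map_mul' g h := by
    ext ⟨_, f, rfl⟩ x
    simp only [LinearMap.comp_apply, LinearMap.codRestrict_apply, LinearMap.rangeRestrict,
      Submodule.subtype_apply, transl_proj, proj_proj, Module.End.mul_apply]
    simp [transl, LinearMap.funLeft, Function.comp_def, mul_assoc]

theorem trace_monomial (L : Subgroup G) (φ : L →* ℂ) (g : G) :
    LinearMap.trace ℂ _ (monomial L φ g) = ind L ⊤ (extend L φ) g := by
  change LinearMap.trace ℂ _ ((proj L φ).rangeRestrict ∘ₗ
    (transl g ∘ₗ (LinearMap.range (proj L φ)).subtype)) = _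
  rw [LinearMap.trace_comp_comm', LinearMap.comp_assoc, LinearMap.subtype_comp_codRestrict,
    LinearMap.trace_eq_matrix_trace ℂ (Pi.basisFun ℂ G), Matrix.trace, ind_top, Finset.mul_sum]
  refine Finset.sum_congr rfl fun x _ => ?_
  rw [Matrix.diag_apply, LinearMap.toMatrix_apply]
  simp only [LinearMap.comp_apply, Pi.basisFun_apply, Pi.basisFun_repr, transl,
    LinearMap.funLeft_apply, proj_apply]
  congr 1
  have key : ∀ h : L, g⁻¹ * x * h = x ↔ (h : G) = x⁻¹ * g * x := by
    intro h
    constructor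
    · intro e
      have : (h : G) = x⁻¹ * g * (g⁻¹ * x * h) := by group
      rwa [e] at this
    · intro e; rw [e]; group
  simp only [Pi.single_apply, mul_ite, mul_one, mul_zero, key]
  by_cases hx : x⁻¹ * g * x ∈ L
  · rw [extend_mem _ hx, Finset.sum_eq_single ⟨_, hx⟩]
    · simp
    · intro b _ hb
      rw [if_neg]
      exact fun e => hb (Subtype.ext e)
    · simp
  · rw [extend_not_mem _ hx, Finset.sum_eq_zero]
    intro b _
    rw [if_neg]
    intro e
    exact hx (e ▸ b.2)

theorem exists_rep_ind (L : Subgroup G) (φ : L →* ℂ) :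
    ∃ V : FDRep ℂ G, V.character = ind L ⊤ (extend L φ) :=
  ⟨FDRep.of (monomial L φ), funext fun g => trace_monomial L φ g⟩

/-- The matrices of the two-dimensional representations of dihedral groups. -/
def dihMatrix {n : ℕ} (ψ : AddChar (ZMod n) ℂ) : DihedralGroup n →* Matrix (Fin 2) (Fin 2) ℂ where
  toFun
    | .r i => !![ψ i, 0; 0, ψ (-i)]
    | .sr i => !![0, ψ (-i); ψ i, 0]
  map_one' := by
    change !![ψ 0, 0; 0, ψ (-0)] = 1
    simp [Matrix.one_fin_two]
  map_mul' := by
    rintro (i | i) (j | j) <;>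
    simp [AddChar.map_add_eq_mul, sub_eq_add_neg, mul_comm]

/-- The two-dimensional representation of `L` obtained from a homomorphism to a dihedral group. -/
def dihRep {n : ℕ} (L : Subgroup G) (Ψ : L →* DihedralGroup n) (ψ : AddChar (ZMod n) ℂ) :
    Representation ℂ L (Fin 2 → ℂ) :=
  (Matrix.toLinAlgEquiv' : _ ≃ₐ[ℂ] ((Fin 2 → ℂ) →ₗ[ℂ] (Fin 2 → ℂ))).toAlgHom.toMonoidHom.comp
    ((dihMatrix ψ).comp Ψ)

theorem dihRep_apply {n : ℕ} (L : Subgroup G) (Ψ : L →* DihedralGroup n) (ψ : AddChar (ZMod n) ℂ)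
    (x : L) : dihRep L Ψ ψ x = Matrix.toLin' (dihMatrix ψ (Ψ x)) := rfl

theorem dihRep_character {n : ℕ} (L : Subgroup G) (Ψ : L →* DihedralGroup n)
    (ψ : AddChar (ZMod n) ℂ) (x : L) :
    (FDRep.of (dihRep L Ψ ψ)).character x = (dihMatrix ψ (Ψ x)).trace := by
  change LinearMap.trace ℂ _ (dihRep L Ψ ψ x) = _
  rw [dihRep_apply, Matrix.trace_toLin'_eq]

theorem detChar_dihRep {n : ℕ} (L : Subgroup G) (Ψ : L →* DihedralGroup n)
    (ψ : AddChar (ZMod n) ℂ) (x : L) :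
    detChar (FDRep.of (dihRep L Ψ ψ)) x = (dihMatrix ψ (Ψ x)).det := by
  change LinearMap.det (dihRep L Ψ ψ x) = _
  rw [dihRep_apply, LinearMap.det_toLin']

theorem trace_sub_det {n : ℕ} (ψ : AddChar (ZMod n) ℂ) (x : DihedralGroup n) :
    (dihMatrix ψ x).trace - 1 - (dihMatrix ψ x).det = dih ψ x := by
  have h : ∀ i, ψ i * ψ (-i) = 1 := fun i => by rw [← AddChar.map_add_eq_mul]; simp
  have h' : ∀ i, ψ (-i) * ψ i = 1 := fun i => by rw [← AddChar.map_add_eq_mul]; simp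
  rcases x with i | i
  · simp [dihMatrix, dih, Matrix.trace_fin_two, Matrix.det_fin_two, h]; ring
  · simp [dihMatrix, dih, Matrix.trace_fin_two, Matrix.det_fin_two, h']

/-- The dihedral group of order four is the Klein four group. -/
def dihedralTwoEquiv :
    DihedralGroup 2 ≃* Multiplicative (ZMod 2) × Multiplicative (ZMod 2) where
  toFun
    | .r i => (Multiplicative.ofAdd 0, Multiplicative.ofAdd i)
    | .sr i => (Multiplicative.ofAdd 1, Multiplicative.ofAdd i)
  invFun p := if p.1.toAdd = 0 then .r p.2.toAdd else .sr p.2.toAdd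
  left_inv := by rintro (i | i) <;> simp
  right_inv := by
    rintro ⟨a, b⟩
    revert a b
    decide
  map_mul' := by
    rintro (i | i) (j | j) <;> revert i j <;> decide

theorem genSpan_top_le (P : AddSubgroup (G → ℂ))
    (h1 : ∀ V W : FDRep ℂ G, V.character 1 = W.character 1 →
      ((V.character - W.character) + star (V.character - W.character)) ∈ P)
    (h2 : ∀ (H : Subgroup G) (τ : FDRep ℂ ↥H), τ.character 1 = 2 →
      ∀ (N : Subgroup ↥H) [N.Normal],
        (∀ n h : ↥H, n ∈ N → τ.character (n * h) = τ.character h) →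
        (Nonempty (↥H ⧸ N ≃* Multiplicative (ZMod 2) × Multiplicative (ZMod 2)) ∨
         Nonempty (↥H ⧸ N ≃* DihedralGroup 4) ∨
         ∃ p : ℕ, p.Prime ∧ Odd p ∧ Nonempty (↥H ⧸ N ≃* DihedralGroup p)) →
        indChar H (τ.character - 1 - detChar τ) ∈ P) :
    genSpan (⊤ : Subgroup G) ≤ P := by
  rw [genSpan, AddSubgroup.closure_le]
  rintro _ ⟨L, -, f, hf, rfl⟩
  rw [SetLike.mem_coe]
  cases hf with
  | linear φ =>
    obtain ⟨V, hV⟩ := exists_rep_ind L φ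
    obtain ⟨W, hW⟩ := exists_rep_ind L (1 : L →* ℂ)
    have := h1 V W ?_
    · convert this using 1
      have hs : ∀ χ : L →* ℂ, star (ind L ⊤ (extend L χ)) = ind L ⊤ (extend L fun x => χ x⁻¹) := by
        intro χ
        ext g
        simp only [Pi.star_apply, ind_top, star_mul', star_inv₀, star_natCast, star_sum]
        congr 1
        refine Finset.sum_congr rfl fun x _ => ?_
        by_cases hx : x⁻¹ * g * x ∈ L
        · rw [extend_mem _ hx, extend_mem _ hx]
          set y : L := ⟨_, hx⟩
          have h1 : χ y ^ orderOf y = 1 := by rw [← map_pow, pow_orderOf_eq_one, map_one]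
          have h2 : ‖χ y‖ = 1 := Complex.norm_eq_one_of_pow_eq_one h1 (orderOf_pos y).ne'
          have h3 : χ y⁻¹ * χ y = 1 := by rw [← map_mul]; simp
          rw [eq_inv_of_mul_eq_one_left h3, Complex.inv_eq_conj h2]
          rfl
        · rw [extend_not_mem _ hx, extend_not_mem _ hx, star_zero]
      rw [star_sub, hV, hW, hs, hs, ← map_sub, ← map_sub, ← map_add]
      congr 1
      ext g
      by_cases hg : g ∈ L
      · simp only [Pi.add_apply, Pi.sub_apply, extend_mem _ hg, MonoidHom.one_apply]; ring
      · simp [extend_not_mem _ hg]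
    · have : ∀ χ : L →* ℂ, ind L ⊤ (extend L χ) 1 = (Nat.card L : ℂ)⁻¹ * Fintype.card G := by
        intro χ
        rw [ind_top]
        have h0 : extend L χ 1 = 1 := by
          rw [extend_mem _ L.one_mem]; exact map_one χ
        simp [h0]
      rw [hV, hW, this, this]
  | dihedral n hn Ψ hΨ ψ =>
    have := h2 L (FDRep.of (dihRep L Ψ ψ)) ?_ Ψ.ker ?_ ?_
    · rw [indChar_eq] at this
      convert this using 3
      ext x
      simp only [Pi.sub_apply, Pi.one_apply, dihRep_character, detChar_dihRep, trace_sub_det]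
    · rw [dihRep_character, map_one, map_one]; simp [Matrix.trace_one]
    · intro m h hm
      rw [dihRep_character, dihRep_character, map_mul, (MonoidHom.mem_ker).1 hm, one_mul]
    · have e := QuotientGroup.quotientKerEquivOfSurjective Ψ hΨ
      rcases hn with rfl | rfl | ⟨hp, ho⟩
      · exact Or.inl ⟨e.trans dihedralTwoEquiv⟩
      · exact Or.inr (Or.inl ⟨e⟩)
      · exact Or.inr (Or.inr ⟨n, hp, ho, ⟨e⟩⟩)

/-- An invariant function whose values are even multiples of the orders of the stabilisers sums
up to an even multiple of the group order. -/
theorem sum_eq_of_stabilizer {Γ X : Type} [Group Γ] [Fintype Γ] [Fintype X] [MulAction Γ X]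
    (F : X → ℂ) (hF : ∀ (g : Γ) x, F (g • x) = F x)
    (hS : ∀ x, ∃ k : ℤ, F x = Nat.card (MulAction.stabilizer Γ x) * (2 * k)) :
    ∃ k : ℤ, ∑ x, F x = Nat.card Γ * (2 * k) := by
  choose m hm using hS
  refine ⟨∑ ω : Quotient (MulAction.orbitRel Γ X), m ω.out, ?_⟩
  rw [Fintype.sum_equiv (MulAction.selfEquivSigmaOrbits Γ X) F (fun p => F p.2) ?_,
    Fintype.sum_sigma]
  · push_cast
    rw [Finset.mul_sum, Finset.mul_sum]
    refine Finset.sum_congr rfl fun ω _ => ?_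
    have h1 : ∀ y : MulAction.orbit Γ ω.out, F y = F ω.out := by
      rintro ⟨_, g, rfl⟩
      exact hF g _
    rw [Finset.sum_congr rfl fun y _ => h1 y, Finset.sum_const, Finset.card_univ, nsmul_eq_mul,
      hm, ← mul_assoc, ← Nat.cast_mul, Nat.card_eq_fintype_card,
      MulAction.card_orbit_mul_card_stabilizer_eq_card_group, Nat.card_eq_fintype_card]
  · intro x
    rfl

/-- The averages of `f` over cyclic groups mapping to `L`, twisted by sign characters, are even
integers. -/
def EvenOn (L : Subgroup G) (f : G → ℂ) : Prop :=
  ∀ (Z : Type) [CommGroup Z] [Fintype Z] [IsCyclic Z] (α : Z →* G), (∀ z, α z ∈ L) →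
    ∀ s : Z →* ℤˣ, ∃ k : ℤ, ∑ z, ((s z : ℤ) : ℂ) * f (α z) = Nat.card Z * (2 * k)

theorem exists_sum_eq_card {Z : Type} [Group Z] [Fintype Z] (χ : Z →* ℂ) :
    ∃ k : ℤ, ∑ z, χ z = Nat.card Z * k := by
  rw [sum_hom_units]
  split_ifs
  · exact ⟨1, by simp⟩
  · exact ⟨0, by simp⟩

theorem exists_sum_linear {Z : Type} [Group Z] [Fintype Z] (s : Z →* ℤˣ) (χ : Z →* ℂ) :
    ∃ k : ℤ, ∑ z, ((s z : ℤ) : ℂ) * (χ z + χ z⁻¹ - 2) = Nat.card Z * (2 * k) := by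
  let s' : Z →* ℂ := ((Int.castRingHom ℂ : ℤ →* ℂ).comp (Units.coeHom ℤ)).comp s
  have hs : ∀ z, s' z = ((s z : ℤ) : ℂ) := fun z => rfl
  obtain ⟨a, ha⟩ := exists_sum_eq_card (s' * χ)
  obtain ⟨b, hb⟩ := exists_sum_eq_card s'
  refine ⟨a - b, ?_⟩
  have h2 : ∑ z, s' z * χ z⁻¹ = ∑ z, s' z * χ z := by
    refine Fintype.sum_equiv (Equiv.inv Z) _ _ fun z => ?_
    simp [hs]
  simp only [MonoidHom.mul_apply] at ha
  simp only [← hs, mul_sub, mul_add, Finset.sum_sub_distrib, Finset.sum_add_distrib, h2, ha,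
    ← Finset.sum_mul, hb]
  push_cast
  ring

theorem dih_comp_cyclic {Z : Type} [CommGroup Z] [IsCyclic Z] {n : ℕ} (ψ : AddChar (ZMod n) ℂ)
    (β : Z →* DihedralGroup n) :
    (∀ z, dih ψ (β z) = 0) ∨ ∃ χ : Z →* ℂ, ∀ z, dih ψ (β z) = χ z + χ z⁻¹ - 2 := by
  obtain ⟨z₀, hz₀⟩ := IsCyclic.exists_generator (α := Z)
  rcases hb : β z₀ with i | i
  · right
    have hr : ∀ z, ∃ j, β z = .r j := by
      intro z
      obtain ⟨k, rfl⟩ := hz₀ z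
      exact ⟨i * k, by simp [hb]⟩
    choose j hj using hr
    have hjm : ∀ x y, j (x * y) = j x + j y := fun x y => by
      have := map_mul β x y
      rw [hj, hj, hj, DihedralGroup.r_mul_r] at this
      exact DihedralGroup.r.inj this
    have hj1 : j 1 = 0 := by
      have := hjm 1 1
      simpa using this
    refine ⟨⟨⟨fun z => ψ (j z), by simp [hj1]⟩, fun x y => by
      simp [hjm, AddChar.map_add_eq_mul]⟩, fun z => ?_⟩
    have hi : j z⁻¹ = - j z := by
      have := hjm z z⁻¹
      rw [mul_inv_cancel, hj1] at this
      exact (neg_eq_of_add_eq_zero_right this.symm).symm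
    simp [hj, dih, hi]
  · left
    intro z
    obtain ⟨k, rfl⟩ := hz₀ z
    have h2 : (DihedralGroup.sr i) ^ (2 : ℤ) = 1 := by
      rw [zpow_ofNat, pow_two, DihedralGroup.sr_mul_sr, sub_self]; rfl
    change dih ψ (β (z₀ ^ k)) = 0
    rw [map_zpow, hb]
    rcases Int.even_or_odd' k with ⟨m, rfl | rfl⟩
    · rw [zpow_mul, h2, one_zpow]
      change ψ 0 + ψ (-0) - 2 = 0
      norm_num
    · rw [zpow_add, zpow_mul, h2, one_zpow, one_mul, zpow_one]
      rfl

theorem IsGen.evenOn {L : Subgroup G} {f : G → ℂ} (hf : IsGen L f) : EvenOn L f := by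
  intro Z _ _ _ α hα s
  let α' : Z →* L := α.codRestrict L hα
  cases hf with
  | linear φ =>
    obtain ⟨k, hk⟩ := exists_sum_linear s (φ.comp α')
    refine ⟨k, ?_⟩
    rw [← hk]
    refine Finset.sum_congr rfl fun z _ => ?_
    rw [extend_mem _ (hα z)]
    simp only [MonoidHom.comp_apply, map_inv]
    rfl
  | dihedral n hn Ψ hΨ ψ =>
    rcases dih_comp_cyclic ψ (Ψ.comp α') with h | ⟨χ, h⟩
    · refine ⟨0, ?_⟩
      rw [Finset.sum_eq_zero]
      · simp
      · intro z _
        rw [extend_mem _ (hα z)]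
        exact mul_eq_zero_of_right _ (h z)
    · obtain ⟨k, hk⟩ := exists_sum_linear s χ
      refine ⟨k, ?_⟩
      rw [← hk]
      refine Finset.sum_congr rfl fun z _ => ?_
      rw [extend_mem _ (hα z)]
      exact congrArg _ (h z)

/-- The action of `Z × L` on `H` by left translations through `α` and by right translations. -/
abbrev biAction {Z : Type} [Group Z] (α : Z →* G) {L H : Subgroup G} (hL : L ≤ H)
    (hα : ∀ z, α z ∈ H) : MulAction (Z × L) H where
  smul p x := ⟨α p.1 * x * (p.2 : G)⁻¹, H.mul_mem (H.mul_mem (hα _) x.2) (H.inv_mem (hL p.2.2))⟩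
  one_smul x := by ext; change α 1 * x * ((1 : L) : G)⁻¹ = x; simp
  mul_smul p q x := by
    ext
    change α (p.1 * q.1) * x * ((p.2 * q.2 : L) : G)⁻¹
      = α p.1 * (α q.1 * x * (q.2 : G)⁻¹) * (p.2 : G)⁻¹
    simp [mul_assoc]

theorem EvenOn.ind {L H : Subgroup G} (hL : L ≤ H) {f : G → ℂ} (hf : EvenOn L f)
    (hc : ∀ x ∈ L, ∀ g, f (x⁻¹ * g * x) = f g) (h0 : ∀ g ∉ L, f g = 0) :
    EvenOn H (ind L H f) := by
  intro Z _ _ _ α hα s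
  let _ := biAction α hL hα
  have smul_def : ∀ (p : Z × L) (x : H), ((p • x : H) : G) = α p.1 * x * (p.2 : G)⁻¹ :=
    fun _ _ => rfl
  have hinv : ∀ (p : Z × L) (x : H),
      ∑ z, ((s z : ℤ) : ℂ) * f (((p • x : H) : G)⁻¹ * α z * (p • x : H))
        = ∑ z, ((s z : ℤ) : ℂ) * f ((x : G)⁻¹ * α z * x) := by
    rintro ⟨w, l⟩ x
    refine Finset.sum_congr rfl fun z _ => ?_
    rw [smul_def, ← hc l l.2]
    congr 2
    have : (α w)⁻¹ * α z * α w = α z := by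
      rw [← map_inv, ← map_mul, ← map_mul]
      congr 1
      rw [mul_comm, mul_inv_cancel_left]
    conv_rhs => rw [← this]
    group
  have hstab : ∀ x : H, ∃ k : ℤ, ∑ z, ((s z : ℤ) : ℂ) * f ((x : G)⁻¹ * α z * x)
      = Nat.card (MulAction.stabilizer (Z × L) x) * (2 * k) := by
    intro x
    let W : Subgroup Z := (L.comap (MulAut.conj (x : G)⁻¹).toMonoidHom).comap α
    have hW : ∀ z, z ∈ W ↔ (x : G)⁻¹ * α z * x ∈ L := by
      intro z
      simp [W, Subgroup.mem_comap]
    obtain ⟨k, hk⟩ := hf W (((MulAut.conj (x : G)⁻¹).toMonoidHom.comp α).comp W.subtype)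
      (fun z => z.2) (s.comp W.subtype)
    refine ⟨k, ?_⟩
    have hmem : ∀ p ∈ MulAction.stabilizer (Z × L) x, (x : G)⁻¹ * α p.1 * x = p.2 := by
      intro p hp
      have := congrArg Subtype.val (MulAction.mem_stabilizer_iff.1 hp)
      rw [smul_def, mul_inv_eq_iff_eq_mul] at this
      rw [mul_assoc, this, inv_mul_cancel_left]
    have hcard : Nat.card (MulAction.stabilizer (Z × L) x) = Nat.card W := by
      refine Nat.card_congr ⟨fun p => ⟨p.1.1, ?_⟩, fun z => ⟨(z.1, ⟨_, (hW z).1 z.2⟩), ?_⟩, ?_, ?_⟩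
      · rw [hW, hmem _ p.2]
        exact p.1.2.2
      · rw [MulAction.mem_stabilizer_iff]
        ext
        rw [smul_def]
        group
      · intro p
        refine Subtype.ext (Prod.ext rfl (Subtype.ext ?_))
        exact hmem _ p.2
      · intro z
        rfl
    rw [hcard, ← hk]
    refine (Finset.sum_subset (Finset.subset_univ (Finset.univ.filter (· ∈ W))) ?_).symm.trans ?_
    · intro z _ hz
      rw [h0 _ (mt (hW z).2 (by simpa using hz)), mul_zero]
    · refine (Finset.sum_subtype (p := (· ∈ W)) (F := (inferInstance : Fintype W)) _ (by simp) _).trans ?_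
      refine Finset.sum_congr rfl fun z _ => ?_
      simp
  obtain ⟨k, hk⟩ := sum_eq_of_stabilizer (Γ := Z × L) (X := H) _ hinv hstab
  refine ⟨k, ?_⟩
  simp only [ind_apply, mul_left_comm _ (Nat.card L : ℂ)⁻¹]
  rw [← Finset.mul_sum]
  simp only [Finset.mul_sum _ _ (((s _ : ℤ) : ℂ))]
  rw [Finset.sum_comm, hk, Nat.card_prod]
  have := card_ne_zero L
  push_cast
  field_simp

theorem evenOn_of_mem_genSpan {H : Subgroup G} {f : G → ℂ} (hf : f ∈ genSpan H) : EvenOn H f := by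
  induction hf using AddSubgroup.closure_induction with
  | mem f hf =>
    obtain ⟨L, hL, f, hf, rfl⟩ := hf
    exact hf.evenOn.ind hL (fun x hx g => hf.conj hx g) (fun g hg => hf.not_mem hg)
  | zero => exact fun Z _ _ _ α hα s => ⟨0, by simp⟩
  | add f g _ _ hf hg =>
    intro Z _ _ _ α hα s
    obtain ⟨a, ha⟩ := hf Z α hα s
    obtain ⟨b, hb⟩ := hg Z α hα s
    refine ⟨a + b, ?_⟩
    simp only [Pi.add_apply, mul_add, Finset.sum_add_distrib, ha, hb]
    push_cast
    ring
  | neg f _ hf =>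
    intro Z _ _ _ α hα s
    obtain ⟨a, ha⟩ := hf Z α hα s
    refine ⟨-a, ?_⟩
    simp only [Pi.neg_apply, mul_neg, Finset.sum_neg_distrib, ha]
    push_cast
    ring

theorem sum_fiber {X Y : Type*} [Fintype X] [Fintype Y] [DecidableEq Y] (f : X → Y) (m : ℕ)
    (h : ∀ y, (Finset.univ.filter (f · = y)).card = m) (F : Y → ℂ) :
    ∑ x, F (f x) = m * ∑ y, F y := by
  rw [← Finset.sum_fiberwise Finset.univ f, Finset.mul_sum]
  refine Finset.sum_congr rfl fun y _ => ?_
  rw [Finset.sum_congr rfl fun x hx => by rw [(Finset.mem_filter.1 hx).2], Finset.sum_const, h,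
    nsmul_eq_mul]

theorem isGen_of_affine {D : Subgroup G} {n : ℕ} (hn : n = 4 ∨ n.Prime ∧ Odd n)
    (a : D →* (ZMod n)ˣ) (b : D → ZMod n) (ha : ∀ g, a g = 1 ∨ a g = -1)
    (hb : ∀ g h, b (g * h) = a g * b h + b g) (hsurj : Function.Surjective b)
    (h : (∀ g, a g = 1) ∨ ∃ k, b k = 0 ∧ a k = -1) (ψ : AddChar (ZMod n) ℂ) :
    IsGen D (extend D fun g => if a g = 1 then ψ (b g) + ψ (-b g) - 2 else 0) := by
  have hb1 : b 1 = 0 := by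
    have := hb 1 1
    simpa using this
  rcases h with h | ⟨k, hk0, hk1⟩
  · have hinv : ∀ g, b g⁻¹ = - b g := by
      intro g
      have := hb g g⁻¹
      rw [mul_inv_cancel, hb1, h, Units.val_one, one_mul] at this
      exact eq_neg_of_add_eq_zero_left this.symm
    have := IsGen.linear (L := D) ⟨⟨fun g => ψ (b g), by simp [hb1]⟩, fun x y => by
      simp [hb, h, AddChar.map_add_eq_mul, mul_comm]⟩
    convert this using 3 with g
    simp [h, hinv]
  · have h2 : 2 < n := by
      rcases hn with rfl | ⟨hp, ho⟩
      · norm_num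
      · exact lt_of_le_of_ne hp.two_le (by rintro rfl; exact absurd ho (by decide))
    have : Fact (2 < n) := ⟨h2⟩
    have hne : (-1 : (ZMod n)ˣ) ≠ 1 := by
      intro h
      exact ZMod.neg_one_ne_one (congrArg Units.val h)
    let Ψ : D →* DihedralGroup n :=
      { toFun := fun g => if a g = 1 then .r (b g) else .sr (-b g)
        map_one' := by simp [hb1]
        map_mul' := by
          intro x y
          rcases ha x with hx | hx <;> rcases ha y with hy | hy <;>
            simp [hx, hy, hb, hne, sub_eq_add_neg, add_comm] }
    have hΨ : Function.Surjective Ψ := by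
      have hex : ∀ i, ∃ g, b g = i ∧ a g = 1 := by
        intro i
        obtain ⟨g, hg⟩ := hsurj i
        rcases ha g with h | h
        · exact ⟨g, hg, h⟩
        · exact ⟨g * k, by rw [hb, hk0, hg, mul_zero, zero_add], by simp [h, hk1]⟩
      rintro (i | i)
      · obtain ⟨g, hg, h⟩ := hex i
        exact ⟨g, by simp [Ψ, hg, h]⟩
      · obtain ⟨g, hg, h⟩ := hex (-i)
        exact ⟨g * k, by simp [Ψ, hb, hk0, hk1, hg, h, hne]⟩
    have := IsGen.dihedral n (Or.inr hn) Ψ hΨ ψ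
    convert this using 3 with g
    simp only [Ψ, MonoidHom.coe_mk, OneHom.coe_mk]
    split_ifs <;> rfl

/-- The product of two groups of order two, as a dihedral group. -/
def signsToDihedral : ℤˣ × ℤˣ →* DihedralGroup 2 where
  toFun p := if p.1 = p.2 then (if p.1 = 1 then .r 0 else .r 1)
    else (if p.1 = 1 then .sr 1 else .sr 0)
  map_one' := by simp
  map_mul' := by decide

theorem isGen_of_signs {L : Subgroup G} (α β : L →* ℤˣ) (hα : α ≠ 1) (hβ : β ≠ 1) (hαβ : α ≠ β) :
    IsGen L (extend L fun g => -((((α g : ℤ) : ℂ) - 1) * (((β g : ℤ) : ℂ) - 1))) := by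
  have h1 : ∃ g, α g = -1 := by
    by_contra! h
    exact hα (MonoidHom.ext fun g => (Int.units_eq_one_or _).resolve_right (h g))
  have h2 : ∃ g, β g = -1 := by
    by_contra! h
    exact hβ (MonoidHom.ext fun g => (Int.units_eq_one_or _).resolve_right (h g))
  have h3 : ∃ g, α g ≠ β g := by
    by_contra! h
    exact hαβ (MonoidHom.ext h)
  obtain ⟨x, hx⟩ := h1
  obtain ⟨y, hy⟩ := h2
  obtain ⟨z, hz⟩ := h3
  have hsurj : Function.Surjective (α.prod β) := by
    have hS : (α.prod β).range = ⊤ := by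
      have h1 : (α x, β x) ∈ (α.prod β).range := ⟨x, rfl⟩
      have h2 : (α y, β y) ∈ (α.prod β).range := ⟨y, rfl⟩
      have h3 : (α z, β z) ∈ (α.prod β).range := ⟨z, rfl⟩
      generalize (α.prod β).range = S at *
      generalize β x = bx at *
      generalize α y = ay at *
      generalize α z = az at *
      generalize β z = bz at *
      rw [hx] at h1
      rw [hy] at h2
      clear hx hy x y z hα hβ hαβ α β
      have h4 := S.mul_mem h1 h2
      have h5 := S.mul_mem h1 h3
      have h0 := S.one_mem
      rw [eq_top_iff]
      rintro ⟨s, t⟩ -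
      have hz' : bz = -az := by
        rcases Int.units_eq_one_or az with rfl | rfl <;>
          rcases Int.units_eq_one_or bz with rfl | rfl <;> simp_all
      subst hz'
      rcases Int.units_eq_one_or s with rfl | rfl <;> rcases Int.units_eq_one_or t with rfl | rfl <;>
        rcases Int.units_eq_one_or bx with rfl | rfl <;>
        rcases Int.units_eq_one_or ay with rfl | rfl <;>
        rcases Int.units_eq_one_or az with rfl | rfl <;>
        first | exact h0 | exact h1 | exact h2 | exact h3 | exact h4 | exact h5
    exact MonoidHom.range_eq_top.1 hS
  let χ : AddChar (ZMod 2) ℂ :=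
    { toFun := fun i => if i = 0 then 1 else -1
      map_zero_eq_one' := by simp
      map_add_eq_mul' := by
        intro i j
        have h : ∀ i : ZMod 2, i = 0 ∨ i = 1 := by decide
        have h2 : (1 + 1 : ZMod 2) = 0 := rfl
        rcases h i with rfl | rfl <;> rcases h j with rfl | rfl <;> simp [h2] }
  have hχ : ∀ i, χ i = if i = 0 then 1 else -1 := fun _ => rfl
  have h1 : dih χ 1 = 0 := by
    change χ 0 + χ (-0) - 2 = 0
    norm_num [hχ]
  have hs : Function.Surjective signsToDihedral := by decide
  have := IsGen.dihedral 2 (Or.inl rfl) (signsToDihedral.comp (α.prod β)) (hs.comp hsurj) χ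
  convert this using 3 with g
  simp only [MonoidHom.comp_apply, MonoidHom.prod_apply]
  rcases Int.units_eq_one_or (α g) with h | h <;> rcases Int.units_eq_one_or (β g) with h' | h' <;>
    simp only [h, h', signsToDihedral, MonoidHom.coe_mk, OneHom.coe_mk] <;>
    norm_num [h1] <;> norm_num [dih, hχ]

/-- The permutation character of `L` on the cosets of the stabiliser of `0` in a transitive action
by affine transformations. -/
theorem perm_affine {K L : Subgroup G} (hK : K ≤ L) {n : ℕ} [NeZero n] (a : L →* (ZMod n)ˣ)
    (b : L → ZMod n) (hb : ∀ g h, b (g * h) = a g * b h + b g) (hsurj : Function.Surjective b)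
    (hb0 : ∀ g : L, b g = 0 ↔ (g : G) ∈ K) (g : L) :
    perm K L g = ∑ t : ZMod n, if (a g - 1) * t + b g = 0 then 1 else 0 := by
  have hdiff : ∀ x y : L, b (x⁻¹ * y) = 0 ↔ b x = b y := by
    intro x y
    have := hb x (x⁻¹ * y)
    rw [mul_inv_cancel_left] at this
    rw [this, right_eq_add, Units.mul_right_eq_zero]
  have hfib : ∀ t, (Finset.univ.filter (b · = t)).card = Nat.card K := by
    intro t
    obtain ⟨x, hx⟩ := hsurj t
    rw [Nat.card_eq_fintype_card, ← Finset.card_univ]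
    refine Finset.card_bij' (fun y hy => ⟨(x⁻¹ * y : L), (hb0 _).1 ((hdiff _ _).2 ?_)⟩)
      (fun k _ => x * ⟨k, hK k.2⟩) ?_ ?_ ?_ ?_
    · rw [hx, (Finset.mem_filter.1 hy).2]
    · intro y hy
      exact Finset.mem_univ _
    · intro k _
      rw [Finset.mem_filter, hb, (hb0 _).2 k.2, hx]
      simp
    · intro y _
      ext
      simp
    · intro k _
      ext
      simp
  rw [perm, ind_apply]
  have : ∀ x : L, one K ((x : G)⁻¹ * g * x) = if (a g - 1) * b x + b g = 0 then 1 else 0 := by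
    intro x
    rw [one_apply]
    refine if_congr ?_ rfl rfl
    have := hb0 (x⁻¹ * (g * x))
    rw [hdiff, hb] at this
    simp only [Subgroup.coe_mul, Subgroup.coe_inv, ← mul_assoc] at this
    rw [← this, sub_mul, one_mul, eq_comm, ← sub_eq_zero]
    ring_nf
  rw [Finset.sum_congr rfl fun x _ => this x,
    sum_fiber b _ hfib fun t => if (a g - 1) * t + b g = 0 then 1 else 0, ← mul_assoc,
    inv_mul_cancel₀ (card_ne_zero K), one_mul]

theorem sum_out_mul {U : Type*} [Group U] [Fintype U] (B : Subgroup U) (S : U → ℂ) :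
    ∑ q : U ⧸ B, ∑ w : B, S (q.out * w) = ∑ u, S u := by
  rw [← Fintype.sum_prod_type' (f := fun (q : U ⧸ B) (w : B) => S (q.out * w))]
  refine Fintype.sum_bijective (fun p : (U ⧸ B) × B => p.1.out * p.2) ⟨?_, fun u => ?_⟩ _ _
    fun _ => rfl
  · rintro ⟨q, w⟩ ⟨q', w'⟩ h
    have hq : q = q' := by
      have := congrArg (QuotientGroup.mk (s := B)) h
      simpa [QuotientGroup.mk_mul_of_mem] using this
    subst hq
    exact Prod.ext rfl (Subtype.ext (mul_left_cancel h))
  · have h : (QuotientGroup.mk (s := B) u).out⁻¹ * u ∈ B := by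
      rw [← QuotientGroup.eq]; simp
    exact ⟨(u, ⟨_, h⟩), mul_inv_cancel_left _ _⟩

theorem sum_out_mul_hom {U Γ : Type*} [Group U] [Fintype U] [Group Γ] [Fintype Γ] (α : Γ →* U)
    (B : Subgroup U) (hB : α.range = B) (S : U → ℂ) :
    ∑ q : U ⧸ B, ∑ γ, S (q.out * α γ) = Nat.card α.ker * ∑ u, S u := by
  have hα : ∀ γ, α γ ∈ B := fun γ => hB ▸ ⟨γ, rfl⟩
  have hs : Function.Surjective (α.codRestrict B hα) := by
    rintro ⟨y, hy⟩
    rw [← hB] at hy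
    obtain ⟨γ, rfl⟩ := hy
    exact ⟨γ, rfl⟩
  rw [← sum_out_mul B, Finset.mul_sum]
  refine Finset.sum_congr rfl fun q _ => ?_
  have h := sum_fiber (α.codRestrict B hα) (Nat.card α.ker) (fun y => ?_) fun w => S (q.out * w)
  · exact h
  rw [MonoidHom.card_fiber_eq_of_mem_range (α.codRestrict B hα) (y := 1) (hs y) (hs 1),
    Nat.card_eq_fintype_card, ← Fintype.card_subtype]
  refine Fintype.card_congr (Equiv.subtypeEquivRight fun γ => ?_)
  rw [MonoidHom.mem_ker, Subtype.ext_iff]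
  rfl

theorem sum_stdAddChar_units {ℓ : ℕ} [Fact ℓ.Prime] (β : ZMod ℓ) :
    ∑ u : (ZMod ℓ)ˣ, (ZMod.stdAddChar (u * β : ZMod ℓ) + ZMod.stdAddChar (-(u * β : ZMod ℓ)) - 2)
      = 2 * ((if β = 0 then (ℓ : ℂ) else 0) - ℓ) := by
  let F : ZMod ℓ → ℂ := fun t => ZMod.stdAddChar (t * β) + ZMod.stdAddChar (-(t * β)) - 2
  have h1 : ∑ u : (ZMod ℓ)ˣ, F u = ∑ t, F t := by
    rw [Fintype.sum_equiv unitsEquivNeZero (fun u : (ZMod ℓ)ˣ => F u) (fun t => F t) fun _ => rfl,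
      ← Fintype.sum_subtype_add_sum_subtype (· = 0) F, right_eq_add]
    refine Finset.sum_eq_zero ?_
    rintro ⟨t, rfl⟩ _
    norm_num [F]
  have h2 := AddChar.sum_mulShift β (ZMod.isPrimitive_stdAddChar ℓ)
  have h3 := AddChar.sum_mulShift (-β) (ZMod.isPrimitive_stdAddChar ℓ)
  refine h1.trans ?_
  simp only [mul_neg, neg_eq_zero, ZMod.card] at h2 h3
  simp only [F, Finset.sum_sub_distrib, Finset.sum_add_distrib, h2, h3, Finset.sum_const,
    Finset.card_univ, ZMod.card]
  split_ifs <;> simp <;> ring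

theorem sum_affine {ℓ : ℕ} [Fact ℓ.Prime] (a : (ZMod ℓ)ˣ) (β : ZMod ℓ) :
    ∑ t : ZMod ℓ, (if ((a : ZMod ℓ) - 1) * t + β = 0 then (1 : ℂ) else 0)
      = if a = 1 then (if β = 0 then (ℓ : ℂ) else 0) else 1 := by
  split_ifs with h h'
  · simp [h, h']
  · simp [h, h']
  · have h0 : (a : ZMod ℓ) - 1 ≠ 0 := fun h' => h (Units.ext (by simpa [sub_eq_zero] using h'))
    rw [Finset.sum_eq_single (-β / (a - 1))]
    · rw [if_pos]
      field_simp
      ring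
    · intro t _ ht
      rw [if_neg]
      intro h
      apply ht
      field_simp
      linear_combination h
    · simp

theorem neg_one_mem_of_card_pow {ℓ : ℕ} [Fact ℓ.Prime] (R : Subgroup (ZMod ℓ)ˣ)
    (h2 : ∃ m, Nat.card R = 2 ^ m) (h : R ≠ ⊥) : -1 ∈ R := by
  obtain ⟨m, hm⟩ := h2
  have : 2 ∣ Nat.card R := by
    rw [hm]
    refine dvd_pow_self 2 ?_
    rintro rfl
    exact h (Subgroup.card_eq_one.1 (by simpa using hm))
  obtain ⟨x, hx⟩ := exists_prime_orderOf_dvd_card' 2 this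
  have h1 : (x : (ZMod ℓ)ˣ) ^ 2 = 1 := by
    rw [← Subgroup.coe_pow, ← hx, pow_orderOf_eq_one]; rfl
  have h2 : (x : (ZMod ℓ)ˣ) ≠ 1 := by
    intro h
    have : x = 1 := Subtype.ext h
    rw [this, orderOf_one] at hx
    exact absurd hx (by decide)
  have h3 : ((x : (ZMod ℓ)ˣ) : ZMod ℓ) ^ 2 = 1 := by rw [← Units.val_pow_eq_pow_val, h1]; rfl
  rcases sq_eq_one_iff.1 h3 with h | h
  · exact absurd (Units.ext h) h2
  · have : (x : (ZMod ℓ)ˣ) = -1 := Units.ext h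
    rw [← this]
    exact x.2

theorem perm_ker {M : Type*} [Group M] {L : Subgroup G} (a : L →* M) (g : L) :
    perm (a.ker.map L.subtype) L g = if a g = 1 then (Nat.card a.range : ℂ) else 0 := by
  rw [perm, ind_apply]
  have h : ∀ x : L, one (a.ker.map L.subtype) ((x : G)⁻¹ * g * x) = if a g = 1 then 1 else 0 := by
    intro x
    rw [one_apply]
    refine if_congr ?_ rfl rfl
    have : (x : G)⁻¹ * g * x = L.subtype (x⁻¹ * g * x) := rfl
    rw [this, Subgroup.mem_map_iff_mem L.subtype_injective, MonoidHom.mem_ker, map_mul, map_mul,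
      map_inv, mul_assoc, inv_mul_eq_one, eq_comm, mul_eq_right]
  rw [Finset.sum_congr rfl fun x _ => h x, Finset.sum_const, Finset.card_univ,
    Subgroup.card_map_of_injective L.subtype_injective, ← Nat.card_eq_fintype_card,
    ← Subgroup.card_mul_index a.ker, Subgroup.index_ker]
  have := card_ne_zero a.ker
  split_ifs
  · rw [nsmul_eq_mul, mul_one, Nat.cast_mul, inv_mul_cancel_left₀ this]
  · simp

theorem perm_not_mem {K L : Subgroup G} (h : K ≤ L) {g : G} (hg : g ∉ L) : perm K L g = 0 :=
  ind_not_mem h (fun _ => extend_not_mem _) hg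

theorem perm_sub_mem_genSpan_of_prime {K L : Subgroup G} (hK : K ≤ L) {ℓ : ℕ} [Fact ℓ.Prime]
    (hℓ : Odd ℓ) (a : L →* (ZMod ℓ)ˣ) (b : L → ZMod ℓ) (hb : ∀ g h, b (g * h) = a g * b h + b g)
    (hb0 : ∀ g : L, b g = 0 ↔ (g : G) ∈ K) (x₀ : L) (hax : a x₀ = 1) (hbx : b x₀ = 1)
    (h2 : ∃ m, Nat.card a.range = 2 ^ m) :
    ∃ t : ℤ, perm K L - one L - t • perm (a.ker.map L.subtype) L ∈ genSpan L := by
  have hb1 : b 1 = 0 := by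
    have := hb 1 1
    simpa using this
  have hax' : ∀ k : ℕ, a (x₀ ^ k) = 1 := fun k => by rw [map_pow, hax, one_pow]
  have hbx' : ∀ k : ℕ, b (x₀ ^ k) = k := by
    intro k
    induction k with
    | zero => simpa using hb1
    | succ k ih => rw [pow_succ, hb, hax', hbx, ih]; push_cast; ring
  have hbxv : ∀ i : ZMod ℓ, b (x₀ ^ i.val) = i := fun i => by rw [hbx', ZMod.natCast_zmod_val]
  have hsurj : Function.Surjective b := fun i => ⟨_, hbxv i⟩
  have hne : (1 : (ZMod ℓ)ˣ) ≠ -1 := by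
    have : Fact (2 < ℓ) := ⟨lt_of_le_of_ne (Fact.out : ℓ.Prime).two_le
      (by rintro rfl; exact absurd hℓ (by decide))⟩
    exact fun h => ZMod.neg_one_ne_one (congrArg Units.val h).symm
  let D' : Subgroup L := (Subgroup.zpowers (-1 : (ZMod ℓ)ˣ)).comap a
  have hD' : ∀ x, x ∈ D' ↔ a x = 1 ∨ a x = -1 := by
    intro x
    rw [Subgroup.mem_comap, Subgroup.mem_zpowers_iff]
    constructor
    · rintro ⟨k, hk⟩
      rw [← hk]
      exact (Int.even_or_odd k).imp Even.neg_one_zpow Odd.neg_one_zpow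
    · rintro (h | h)
      · exact ⟨0, by simp [h]⟩
      · exact ⟨1, by simp [h]⟩
  let D : Subgroup G := D'.map L.subtype
  have hDL : D ≤ L := by
    rintro _ ⟨x, _, rfl⟩
    exact x.2
  have hDmem : ∀ x : L, (x : G) ∈ D ↔ x ∈ D' := fun x =>
    Subgroup.mem_map_iff_mem L.subtype_injective
  let i : D →* L := Subgroup.inclusion hDL
  let S : (ZMod ℓ)ˣ → ZMod ℓ → ℂ := fun u β =>
    ZMod.stdAddChar (u * β : ZMod ℓ) + ZMod.stdAddChar (-(u * β : ZMod ℓ)) - 2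
  let F : (ZMod ℓ)ˣ → G → ℂ := fun u => extend D fun g => if a (i g) = 1 then S u (b (i g)) else 0
  have hgen : ∀ u, IsGen D (F u) := by
    intro u
    have := isGen_of_affine (D := D) (Or.inr ⟨Fact.out, hℓ⟩) (a.comp i) (fun g => b (i g))
      (fun g => (hD' _).1 ((hDmem _).1 g.2)) (fun g h => by rw [map_mul, hb]; rfl) ?_ ?_
      (ZMod.stdAddChar.mulShift (u : ZMod ℓ))
    · convert this using 3 with g
      simp [S, AddChar.mulShift_apply]
    · intro t
      exact ⟨⟨_, (hDmem _).2 ((hD' _).2 (Or.inl (hax' t.val)))⟩, hbxv t⟩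
    · by_cases hR : a.range = ⊥
      · left
        intro g
        exact Subgroup.mem_bot.1 (hR ▸ ⟨i g, rfl⟩)
      · right
        obtain ⟨y, hy⟩ := neg_one_mem_of_card_pow a.range h2 hR
        have h1 : a (y * x₀ ^ (b y).val) = -1 := by rw [map_mul, hax', hy, mul_one]
        refine ⟨⟨_, (hDmem _).2 ((hD' _).2 (Or.inr h1))⟩, ?_, h1⟩
        change b (y * x₀ ^ (b y).val) = 0
        rw [hb, hbxv, hy]
        simp
  have hFval : ∀ u (g x : L), F u ((x : G)⁻¹ * g * x)
      = if a g = 1 then S (u * (a x)⁻¹) (b g) else 0 := by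
    intro u g x
    have hc : (x : G)⁻¹ * g * x = (x⁻¹ * g * x : L) := rfl
    have hac : a (x⁻¹ * g * x) = a g := by
      rw [map_mul, map_mul, mul_comm, ← mul_assoc, ← map_mul]; simp
    by_cases hg : (x : G)⁻¹ * g * x ∈ D
    · change extend D _ _ = _
      rw [extend_mem _ hg]
      change (if a (x⁻¹ * g * x) = 1 then S u (b (x⁻¹ * g * x)) else 0) = _
      rw [hac]
      split_ifs with h
      · have h3 := hb x (x⁻¹ * g * x)
        have h4 := hb g x
        rw [show x * (x⁻¹ * g * x) = g * x by group, h4, h, Units.val_one, one_mul] at h3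
        have h5 : b g = a x * b (x⁻¹ * g * x) := by linear_combination h3
        have h6 : (u * (a x)⁻¹ : (ZMod ℓ)ˣ) * b g = u * b (x⁻¹ * g * x) := by
          rw [h5, Units.val_mul, mul_assoc, Units.inv_mul_cancel_left]
        simp only [S, h6]
      · rfl
    · change extend D _ _ = _
      rw [extend_not_mem _ hg, if_neg]
      intro h
      rw [hc, hDmem, hD', hac] at hg
      exact hg (Or.inl h)
  let sgn : ℤˣ →* (ZMod ℓ)ˣ := Units.map (Int.castRingHom (ZMod ℓ) : ℤ →* ZMod ℓ)
  have hsgn1 : sgn (-1) = -1 := by ext; simp [sgn]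
  let α : L × ℤˣ →* (ZMod ℓ)ˣ := a⁻¹.coprod sgn
  have hα : ∀ p, α p = (a p.1)⁻¹ * sgn p.2 := fun p => rfl
  have hker : Nat.card α.ker = Nat.card D := by
    rw [Subgroup.card_map_of_injective L.subtype_injective]
    refine Nat.card_eq_of_bijective (fun p => (⟨p.1.1, (hD' _).2 ?_⟩ : D')) ⟨?_, ?_⟩
    · have := MonoidHom.mem_ker.1 p.2
      rw [hα, inv_mul_eq_one] at this
      rw [this]
      rcases Int.units_eq_one_or p.1.2 with h | h
      · left; rw [h, map_one]
      · right; rw [h, hsgn1]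
    · rintro ⟨⟨x, s⟩, hp⟩ ⟨⟨y, s'⟩, hp'⟩ h
      have hxy : x = y := congrArg Subtype.val h
      subst hxy
      rw [MonoidHom.mem_ker, hα, inv_mul_eq_one] at hp hp'
      have : s = s' := by
        have hs : sgn s = sgn s' := hp.symm.trans hp'
        rcases Int.units_eq_one_or s with rfl | rfl <;>
          rcases Int.units_eq_one_or s' with rfl | rfl
        · rfl
        · rw [map_one, hsgn1] at hs; exact absurd hs hne
        · rw [map_one, hsgn1] at hs; exact absurd hs.symm hne
        · rfl
      subst this
      rfl
    · rintro ⟨x, hx⟩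
      rcases (hD' x).1 hx with h | h
      · exact ⟨⟨(x, 1), by rw [MonoidHom.mem_ker, hα]; simp [h]⟩, rfl⟩
      · exact ⟨⟨(x, -1), by rw [MonoidHom.mem_ker, hα]; simp [h, hsgn1]⟩, rfl⟩
  obtain ⟨B, hB⟩ : ∃ B, α.range = B := ⟨_, rfl⟩
  have hsumS : ∀ β, ∑ q : (ZMod ℓ)ˣ ⧸ B, ∑ x : L, S (q.out * (a x)⁻¹) β
      = Nat.card D * ((if β = 0 then (ℓ : ℂ) else 0) - ℓ) := by
    intro β
    have h1 := sum_out_mul_hom α B hB fun u => S u β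
    rw [hker, sum_stdAddChar_units] at h1
    have h3 : ∀ u, ∑ p, S (u * α p) β = 2 * ∑ x : L, S (u * (a x)⁻¹) β := by
      intro u
      rw [Fintype.sum_prod_type, Finset.mul_sum]
      refine Finset.sum_congr rfl fun x _ => ?_
      have h4 : ∀ s : ℤˣ, S (u * α (x, s)) β = S (u * (a x)⁻¹) β := by
        intro s
        rw [hα]
        rcases Int.units_eq_one_or s with rfl | rfl
        · rw [map_one, mul_one]
        · simp only [hsgn1, S, Units.val_mul, Units.val_neg, mul_neg, mul_one,
            neg_mul, neg_neg]
          ring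
      rw [Finset.sum_congr rfl fun s _ => h4 s]
      simp
    simp only [h3, ← Finset.mul_sum] at h1
    linear_combination h1 / 2
  obtain ⟨t, ht⟩ : Nat.card a.range ∣ ℓ - 1 := by
    rw [← ZMod.card_units ℓ, ← Nat.card_eq_fintype_card]
    exact Subgroup.card_subgroup_dvd_card _
  refine ⟨t, ?_⟩
  have hmem : ∑ q : (ZMod ℓ)ˣ ⧸ B, ind D L (F q.out) ∈ genSpan L :=
    sum_mem fun q _ => (hgen _).mem_genSpan hDL
  convert hmem using 1
  ext g
  by_cases hg : g ∈ L
  · lift g to L using hg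
    rw [Finset.sum_apply]
    simp only [ind_apply, hFval, Pi.sub_apply, Pi.smul_apply, perm_ker, one_apply, SetLike.coe_mem,
      if_true]
    rw [perm_affine hK a b hb hsurj hb0, sum_affine, ← Finset.mul_sum]
    split_ifs with h h0
    · rw [hsumS, if_pos h0]
      have ht' : ((ℓ - 1 : ℕ) : ℂ) = Nat.card a.range * t := by rw [ht, Nat.cast_mul]
      rw [Nat.cast_sub (Fact.out : ℓ.Prime).one_le] at ht'
      rw [sub_self, mul_zero, mul_zero, zsmul_eq_mul]
      linear_combination ht'
    · rw [hsumS, if_neg h0]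
      have ht' : ((ℓ - 1 : ℕ) : ℂ) = Nat.card a.range * t := by rw [ht, Nat.cast_mul]
      rw [Nat.cast_sub (Fact.out : ℓ.Prime).one_le] at ht'
      rw [inv_mul_cancel_left₀ (card_ne_zero D), zsmul_eq_mul]
      linear_combination ht'
    · simp
  · rw [Finset.sum_apply, Finset.sum_eq_zero fun q _ =>
      ind_not_mem hDL (fun _ => (hgen _).not_mem) hg, Pi.sub_apply, Pi.sub_apply, Pi.smul_apply,
      perm_not_mem hK hg, perm_not_mem _ hg, one_apply, if_neg hg]
    · simp
    · rintro _ ⟨x, _, rfl⟩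
      exact x.2

theorem card_mul_perm_one (K L : Subgroup G) : Nat.card K * perm K L 1 = Nat.card L := by
  rw [perm, ind_apply, mul_inv_cancel_left₀ (card_ne_zero K)]
  simp [one_apply, K.one_mem]

/-- A subgroup `H` with a normal cyclic subgroup of odd order and `2`-group quotient. -/
def IsHyper (H : Subgroup G) (c : G) : Prop :=
  c ∈ H ∧ Odd (orderOf c) ∧ (∀ h ∈ H, h * c * h⁻¹ ∈ Subgroup.zpowers c) ∧
    ∀ h ∈ H, ∃ k : ℕ, h ^ 2 ^ k ∈ Subgroup.zpowers c

theorem exists_conj_eq_zpow {H : Subgroup G} {c c₀ : G} (hc : IsHyper H c)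
    (h0 : c₀ ∈ Subgroup.zpowers c) {h : G} (hh : h ∈ H) : ∃ j : ℤ, h * c₀ * h⁻¹ = c₀ ^ j := by
  obtain ⟨i, rfl⟩ := h0
  obtain ⟨j, hj⟩ := hc.2.2.1 h hh
  refine ⟨j, ?_⟩
  change c ^ j = _ at hj
  change h * c ^ i * h⁻¹ = (c ^ i) ^ j
  rw [← conj_zpow, ← hj, ← zpow_mul, ← zpow_mul, mul_comm]

theorem zpow_conj_eq {g c : G} {j : ℤ} (h : g * c * g⁻¹ = c ^ j) (i : ℤ) :
    g * c ^ i = c ^ (j * i) * g := by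
  rw [zpow_mul, ← h, conj_zpow, inv_mul_cancel_right]

theorem exists_prime_zpow_mem_iff {K : Subgroup G} {c : G} (hc : Odd (orderOf c)) (hcK : c ∉ K) :
    ∃ ℓ : ℕ, ℓ.Prime ∧ Odd ℓ ∧
      ∃ c₀ ∈ Subgroup.zpowers c, ∀ i : ℤ, c₀ ^ i ∈ K ↔ (ℓ : ℤ) ∣ i := by
  let A : AddSubgroup ℤ :=
    { carrier := {i | c ^ i ∈ K}
      zero_mem' := by simp [K.one_mem]
      add_mem' := fun {i j} hi hj => by
        simp only [Set.mem_ofPred_eq, zpow_add]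
        exact K.mul_mem hi hj
      neg_mem' := fun {i} hi => by
        simp only [Set.mem_ofPred_eq, zpow_neg]
        exact K.inv_mem hi }
  have hA : ∀ i : ℤ, i ∈ A ↔ c ^ i ∈ K := fun _ => Iff.rfl
  obtain ⟨d, hd⟩ := Int.subgroup_cyclic A
  have hd' : ∀ i : ℤ, c ^ i ∈ K ↔ (d.natAbs : ℤ) ∣ i := by
    intro i
    rw [← hA, hd, ← AddSubgroup.zmultiples_eq_closure, Int.mem_zmultiples_iff, Int.natAbs_dvd]
  have hne : d.natAbs ≠ 1 := fun h => hcK (by simpa using (hd' 1).2 (by simp [h]))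
  have hdvd : d.natAbs ∣ orderOf c := by
    have := (hd' (orderOf c)).1 (by simp [K.one_mem])
    exact_mod_cast this
  obtain ⟨ℓ, hℓ, e, he⟩ := Nat.exists_prime_and_dvd hne
  refine ⟨ℓ, hℓ, hc.of_dvd_nat ((Dvd.intro _ he.symm).trans hdvd), c ^ e, ⟨e, by simp⟩, fun i => ?_⟩
  have he0 : (e : ℤ) ≠ 0 := by
    rintro h
    have : d.natAbs = 0 := by rw [he, Nat.cast_eq_zero.1 h, mul_zero]
    rw [this, zero_dvd_iff] at hdvd
    exact (orderOf_pos c).ne' hdvd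
  rw [← zpow_natCast c e, ← zpow_mul, hd', he, Nat.cast_mul, mul_comm, mul_dvd_mul_iff_left he0]

theorem exists_sub_mem_genSpan_of_hyper {H K : Subgroup G} {c : G} (hc : IsHyper H c) (hK : K ≤ H)
    (hcK : c ∉ K) : ∃ L ≤ H, Nat.card K < Nat.card L ∧ ∃ N ≤ H, Nat.card K < Nat.card N ∧
      ∃ t : ℤ, perm K H - perm L H - t • perm N H ∈ genSpan H := by
  obtain ⟨ℓ, hℓ, hℓodd, c₀, hc₀, hpow⟩ := exists_prime_zpow_mem_iff hc.2.1 hcK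
  have : Fact ℓ.Prime := ⟨hℓ⟩
  have hpow' : ∀ i j : ℤ, c₀ ^ (i - j) ∈ K ↔ (i : ZMod ℓ) = j := by
    intro i j
    rw [hpow, ← ZMod.intCast_zmod_eq_zero_iff_dvd, Int.cast_sub, sub_eq_zero]
  have hexp : ∀ i j : ℤ, c₀ ^ i = c₀ ^ j → (i : ZMod ℓ) = j := by
    intro i j h
    rw [← hpow', zpow_sub, h, mul_inv_cancel]
    exact K.one_mem
  have hzc : Subgroup.zpowers c ≤ H := by
    rw [Subgroup.zpowers_le]
    exact hc.1
  have hconj : ∀ g ∈ H, ∃ j : ℤ, g * c₀ * g⁻¹ = c₀ ^ j := fun g hg =>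
    exists_conj_eq_zpow hc hc₀ hg
  let L : Subgroup G :=
    { carrier := {g | ∃ i : ℤ, ∃ k ∈ K, g = c₀ ^ i * k}
      one_mem' := ⟨0, 1, K.one_mem, by simp⟩
      mul_mem' := by
        rintro _ _ ⟨i, k, hk, rfl⟩ ⟨i', k', hk', rfl⟩
        obtain ⟨j, hj⟩ := hconj k (hK hk)
        refine ⟨i + j * i', k * k', K.mul_mem hk hk', ?_⟩
        rw [mul_assoc, ← mul_assoc k, zpow_conj_eq hj, zpow_add]
        group
      inv_mem' := by
        rintro _ ⟨i, k, hk, rfl⟩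
        obtain ⟨j, hj⟩ := hconj k⁻¹ (hK (K.inv_mem hk))
        refine ⟨j * -i, k⁻¹, K.inv_mem hk, ?_⟩
        rw [← zpow_conj_eq hj, mul_inv_rev, zpow_neg] }
  have hLmem : ∀ i : ℤ, ∀ k ∈ K, c₀ ^ i * k ∈ L := fun i k hk => ⟨i, k, hk, rfl⟩
  have hLH : L ≤ H := by
    rintro _ ⟨i, k, hk, rfl⟩
    exact H.mul_mem (H.zpow_mem (hzc hc₀) i) (hK hk)
  have hKL : K ≤ L := fun k hk => by simpa using hLmem 0 k hk
  choose bz hbz using fun g : L => g.2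
  choose az haz using fun g : L => hconj g (hLH g.2)
  have hb : ∀ (g : L) (i : ℤ), ∀ k ∈ K, (g : G) = c₀ ^ i * k → (bz g : ZMod ℓ) = i := by
    intro g i k hk h
    obtain ⟨k', hk', h'⟩ := hbz g
    rw [← hpow', sub_eq_neg_add]
    have : c₀ ^ (-i + bz g) = k * k'⁻¹ := by
      rw [eq_mul_inv_iff_mul_eq, zpow_add, mul_assoc, ← h', h, zpow_neg, inv_mul_cancel_left]
    rw [this]
    exact K.mul_mem hk (K.inv_mem hk')
  have ha : ∀ (g : L) (j : ℤ), (g : G) * c₀ * (g : G)⁻¹ = c₀ ^ j → (az g : ZMod ℓ) = j :=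
    fun g j h => hexp _ _ ((haz g).symm.trans h)
  let a : L →* (ZMod ℓ)ˣ := MonoidHom.toHomUnits
    { toFun := fun g => (az g : ZMod ℓ)
      map_one' := by
        rw [ha 1 1 (by simp)]
        simp
      map_mul' := fun g h => by
        rw [ha (g * h) (az g * az h), Int.cast_mul]
        rw [zpow_mul, ← haz g, conj_zpow, ← haz h]
        simp [mul_assoc] }
  have haval : ∀ g, ((a g : (ZMod ℓ)ˣ) : ZMod ℓ) = az g := fun g => rfl
  let x₀ : L := ⟨c₀, by simpa using hLmem 1 1 K.one_mem⟩
  have hcocycle : ∀ g h : L, (bz (g * h) : ZMod ℓ) = a g * bz h + bz g := by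
    intro g h
    obtain ⟨k, hk, hg⟩ := hbz g
    obtain ⟨k', hk', hh⟩ := hbz h
    rw [haval, hb (g * h) (az g * bz h + bz g) (k * k') (K.mul_mem hk hk')]
    · push_cast
      rfl
    · rw [Subgroup.coe_mul]
      rw [hh, ← mul_assoc, zpow_conj_eq (haz g), zpow_add, mul_assoc, mul_assoc, hg]
      group
  have hb0 : ∀ g : L, (bz g : ZMod ℓ) = 0 ↔ (g : G) ∈ K := by
    intro g
    constructor
    · intro h
      obtain ⟨k, hk, hg⟩ := hbz g
      rw [ZMod.intCast_zmod_eq_zero_iff_dvd, ← hpow] at h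
      rw [hg]
      exact K.mul_mem h hk
    · intro h
      rw [hb g 0 g h (by simp), Int.cast_zero]
  have hax : a x₀ = 1 := by
    ext
    rw [haval, ha x₀ 1 (by simp [x₀])]
    simp
  have hbx : (bz x₀ : ZMod ℓ) = 1 := by
    rw [hb x₀ 1 1 K.one_mem (by simp [x₀]), Int.cast_one]
  have h2 : ∃ m, Nat.card a.range = 2 ^ m := by
    rw [← IsPGroup.iff_card]
    rintro ⟨_, g, rfl⟩
    obtain ⟨k, hk⟩ := hc.2.2.2 g (hLH g.2)
    refine ⟨k, ?_⟩
    have hcomm : Commute ((g : G) ^ 2 ^ k) c₀ := by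
      obtain ⟨i, hi⟩ := hk
      obtain ⟨j, rfl⟩ := hc₀
      rw [← hi]
      exact ((Commute.refl c).zpow_right j).zpow_left i
    ext
    change ((a g ^ 2 ^ k : (ZMod ℓ)ˣ) : ZMod ℓ) = 1
    rw [← map_pow, haval, ha _ 1, Int.cast_one]
    rw [Subgroup.coe_pow, hcomm.eq, mul_inv_cancel_right, zpow_one]
  obtain ⟨t, ht⟩ := perm_sub_mem_genSpan_of_prime hKL hℓodd a (fun g => (bz g : ZMod ℓ)) hcocycle
    hb0 x₀ hax hbx h2
  have hNL : a.ker.map L.subtype ≤ L := by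
    rintro _ ⟨x, _, rfl⟩
    exact x.2
  have hcardL : Nat.card L = Nat.card K * ℓ := by
    have h := card_mul_perm_one K L
    have h' := perm_affine hKL a (fun g => (bz g : ZMod ℓ)) hcocycle ?_ hb0 1
    · rw [sum_affine, if_pos (map_one a), if_pos ((hb0 1).2 K.one_mem)] at h'
      rw [show ((1 : L) : G) = 1 from rfl] at h'
      rw [h'] at h
      exact_mod_cast h.symm
    · intro i
      refine ⟨⟨c₀ ^ (i.val : ℤ), by simpa using hLmem i.val 1 K.one_mem⟩, ?_⟩
      change (bz _ : ZMod ℓ) = i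
      rw [hb _ i.val 1 K.one_mem (by simp)]
      simp
  refine ⟨L, hLH, ?_, a.ker.map L.subtype, hNL.trans hLH, ?_, t, ?_⟩
  · rw [hcardL]
    exact lt_mul_of_one_lt_right Nat.card_pos hℓ.one_lt
  · rw [Subgroup.card_map_of_injective L.subtype_injective]
    have h1 := Subgroup.card_mul_index a.ker
    rw [Subgroup.index_ker, hcardL] at h1
    have h3 : Nat.card a.range < ℓ := by
      refine (Nat.card_le_card_of_injective _ a.range.subtype_injective).trans_lt ?_
      rw [Nat.card_eq_fintype_card, ZMod.card_units]
      exact Nat.sub_lt hℓ.pos one_pos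
    have h4 : 0 < Nat.card K := Nat.card_pos
    by_contra! h5
    nlinarith [Nat.mul_le_mul_right (Nat.card a.range) h5]
  · have := ind_mem_genSpan hLH ht
    rwa [map_sub, map_sub, map_zsmul, ind_perm _ hLH, ind_perm _ hLH, ind_one] at this

/-- A sign character of a subgroup, extended by zero. -/
def sgn (L : Subgroup G) (δ : L →* ℤˣ) : G → ℂ := extend L fun x => ((δ x : ℤ) : ℂ)

theorem sgn_one (L : Subgroup G) : sgn L 1 = one L := by
  simp [sgn, one]

theorem sgn_coe {L : Subgroup G} (δ : L →* ℤˣ) (g : L) : sgn L δ g = ((δ g : ℤ) : ℂ) :=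
  extend_mem _ g.2

theorem perm_ker_sign {L : Subgroup G} (δ : L →* ℤˣ) (hδ : δ ≠ 1) :
    perm (δ.ker.map L.subtype) L = one L + sgn L δ := by
  ext g
  by_cases hg : g ∈ L
  · lift g to L using hg
    have hr : δ.range = ⊤ := by
      rw [eq_top_iff]
      obtain ⟨x, hx⟩ : ∃ x, δ x ≠ 1 := by
        by_contra! h
        exact hδ (MonoidHom.ext h)
      rintro u -
      rcases Int.units_eq_one_or u with rfl | rfl
      · exact one_mem _
      · exact ⟨x, (Int.units_eq_one_or _).resolve_left hx⟩
    rw [perm_ker, hr, Pi.add_apply, one_apply, if_pos g.2, sgn_coe]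
    rcases Int.units_eq_one_or (δ g) with h | h <;> rw [h] <;> norm_num
  · rw [perm_not_mem _ hg, Pi.add_apply, one_apply, if_neg hg, sgn, extend_not_mem _ hg, add_zero]
    rintro _ ⟨x, _, rfl⟩
    exact x.2

/-- The sign by which a unit modulo `4` acts. -/
def unitSign : (ZMod 4)ˣ →* ℤˣ where
  toFun u := if u = 1 then 1 else -1
  map_one' := by decide
  map_mul' := by decide

/-- The parity of a residue modulo `4`. -/
def paritySign (x : ZMod 4) : ℤˣ := if x = 0 ∨ x = 2 then 1 else -1

theorem paritySign_affine : ∀ (u : (ZMod 4)ˣ) (x y : ZMod 4),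
    paritySign (u * y + x) = paritySign x * paritySign y := by
  decide

theorem stdAddChar_two : ZMod.stdAddChar (2 : ZMod 4) = -1 := by
  have h : ZMod.stdAddChar (2 : ZMod 4) ^ 2 = 1 := by
    rw [← AddChar.map_nsmul_eq_pow]
    exact AddChar.map_zero_eq_one _
  refine (sq_eq_one_iff.1 h).resolve_left fun h' => ?_
  rw [← AddChar.map_zero_eq_one (ZMod.stdAddChar (N := 4))] at h'
  exact absurd (ZMod.injective_stdAddChar h') (by decide)

theorem stdAddChar_add_stdAddChar_neg (x : ZMod 4) :
    ZMod.stdAddChar x + ZMod.stdAddChar (-x) - 2 =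
      ((if x = 0 then 0 else if x = 2 then -4 else -2 : ℤ) : ℂ) := by
  have h : ZMod.stdAddChar (3 : ZMod 4) = -ZMod.stdAddChar (1 : ZMod 4) := by
    rw [show (3 : ZMod 4) = 2 + 1 from rfl, AddChar.map_add_eq_mul, stdAddChar_two, neg_one_mul]
  obtain rfl | rfl | rfl | rfl : x = 0 ∨ x = 1 ∨ x = 2 ∨ x = 3 := by
    revert x
    decide
  · norm_num
  · rw [show (-1 : ZMod 4) = 3 from rfl, h, if_neg (by decide), if_neg (by decide)]
    norm_num
  · rw [show (-2 : ZMod 4) = 2 from rfl, stdAddChar_two, if_neg (by decide), if_pos rfl]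
    norm_num
  · rw [show (-3 : ZMod 4) = 1 from rfl, h, if_neg (by decide), if_neg (by decide)]
    norm_num

theorem sum_ite_affine_four : ∀ (u : (ZMod 4)ˣ) (x : ZMod 4),
    (∑ t : ZMod 4, if ((u : ZMod 4) - 1) * t + x = 0 then (1 : ℤ) else 0) =
      (if u = 1 then if x = 0 then 0 else if x = 2 then -4 else -2 else 0) + 1 + 1
        + unitSign u + paritySign x := by
  decide

theorem perm_sub_mem_genSpan_of_four {K L : Subgroup G} (hK : K ≤ L) (a : L →* (ZMod 4)ˣ)
    (b : L → ZMod 4) (hb : ∀ g h, b (g * h) = a g * b h + b g) (hsurj : Function.Surjective b)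
    (hb0 : ∀ g : L, b g = 0 ↔ (g : G) ∈ K) :
    ∃ α β : L →* ℤˣ, (∀ g, β g = paritySign (b g)) ∧
      perm K L - one L - one L - sgn L α - sgn L β ∈ genSpan L := by
  have ha : ∀ g, a g = 1 ∨ a g = -1 := fun g => by
    generalize a g = u
    revert u
    decide
  have hb1 : b 1 = 0 := (hb0 1).2 K.one_mem
  let β : L →* ℤˣ :=
    { toFun := fun g => paritySign (b g)
      map_one' := by rw [hb1]; decide
      map_mul' := fun g h => by rw [hb, paritySign_affine] }
  refine ⟨unitSign.comp a, β, fun _ => rfl, ?_⟩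
  let F : G → ℂ := extend L fun g =>
    if a g = 1 then ZMod.stdAddChar (b g) + ZMod.stdAddChar (-b g) - 2 else 0
  have hF : IsGen L F := by
    by_cases h1 : ∀ g, a g = 1
    · exact isGen_of_affine (Or.inl rfl) a b ha hb hsurj (Or.inl h1) _
    by_cases h2 : ∃ k, b k = 0 ∧ a k = -1
    · exact isGen_of_affine (Or.inl rfl) a b ha hb hsurj (Or.inr h2) _
    push Not at h1 h2
    have h4 : ∀ g, a g = -1 → b g ≠ 2 := by
      intro g hg hbg
      obtain ⟨h, hh⟩ := hsurj 1
      refine h2 (h⁻¹ * (g * h)) ?_ ?_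
      · have h5 := hb h (h⁻¹ * (g * h))
        rw [mul_inv_cancel_left, hb, hg, hbg, hh] at h5
        have h6 : ((a h : (ZMod 4)ˣ) : ZMod 4) * b (h⁻¹ * (g * h)) = 0 := by
          rw [Units.val_neg, Units.val_one] at h5
          linear_combination -h5
        exact (Units.mul_right_eq_zero _).1 h6
      · rw [map_mul, map_mul, mul_left_comm, ← map_mul, inv_mul_cancel, map_one, mul_one, hg]
    have h5 : ∀ g, a g = -1 → b g = 1 ∨ b g = 3 := by
      intro g hg
      have h6 := h4 g hg
      have h7 := fun h => h2 g h hg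
      generalize b g = x at *
      revert x
      decide
    obtain ⟨g₀, hg₀⟩ := h1
    have hg₀' := (ha g₀).resolve_left hg₀
    have h6 : ∀ g, a g = if b g = 0 ∨ b g = 2 then 1 else -1 := by
      intro g
      rcases ha g with h | h
      · have h7 : a (g * g₀) = -1 := by rw [map_mul, h, hg₀', one_mul]
        have h8 := h5 _ h7
        have h9 := h5 _ hg₀'
        rw [hb, h] at h8
        rw [h]
        generalize b g = x at *
        generalize b g₀ = y at *
        revert x y
        decide
      · rw [h, if_neg]
        have := h5 g h
        generalize b g = x at *
        revert x
        decide
    have hb' : ∀ g h, b (g * h) = (if b g = 0 ∨ b g = 2 then 1 else -1) * b h + b g := by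
      intro g h
      rw [hb, h6]
      split_ifs <;> rfl
    let σ : ZMod 4 → ℤˣ := fun x => if x = 1 ∨ x = 2 then -1 else 1
    let σ' : ZMod 4 → ℤˣ := fun x => if x = 2 ∨ x = 3 then -1 else 1
    have hσ : ∀ x y : ZMod 4, σ ((if x = 0 ∨ x = 2 then 1 else -1) * y + x) = σ x * σ y := by
      decide
    have hσ' : ∀ x y : ZMod 4, σ' ((if x = 0 ∨ x = 2 then 1 else -1) * y + x) = σ' x * σ' y := by
      decide
    let α₁ : L →* ℤˣ :=
      { toFun := fun g => σ (b g)
        map_one' := by rw [hb1]; decide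
        map_mul' := fun g h => by rw [hb', hσ] }
    let α₂ : L →* ℤˣ :=
      { toFun := fun g => σ' (b g)
        map_one' := by rw [hb1]; decide
        map_mul' := fun g h => by rw [hb', hσ'] }
    have hα₁ : ∀ g, α₁ g = σ (b g) := fun _ => rfl
    have hα₂ : ∀ g, α₂ g = σ' (b g) := fun _ => rfl
    obtain ⟨y₁, hy₁⟩ := hsurj 1
    obtain ⟨y₂, hy₂⟩ := hsurj 2
    have h7 := isGen_of_signs α₁ α₂ ?_ ?_ ?_
    · convert h7 using 3 with g
      rw [h6, hα₁, hα₂, stdAddChar_add_stdAddChar_neg]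
      generalize b g = x
      have hx : (if (if x = 0 ∨ x = 2 then (1 : (ZMod 4)ˣ) else -1) = 1 then
          if x = 0 then 0 else if x = 2 then -4 else -2 else 0 : ℤ) =
          -(((σ x : ℤ) - 1) * ((σ' x : ℤ) - 1)) := by
        revert x
        decide
      exact_mod_cast hx
    · intro h
      have := DFunLike.congr_fun h y₁
      rw [hα₁, hy₁, MonoidHom.one_apply] at this
      exact absurd this (by decide)
    · intro h
      have := DFunLike.congr_fun h y₂
      rw [hα₂, hy₂, MonoidHom.one_apply] at this
      exact absurd this (by decide)
    · intro h
      have := DFunLike.congr_fun h y₁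
      rw [hα₁, hα₂, hy₁] at this
      exact absurd this (by decide)
  convert hF.mem_genSpan_self using 1
  ext g
  by_cases hg : g ∈ L
  · lift g to L using hg
    simp only [Pi.sub_apply, one_apply, g.2, if_true, sgn_coe, F, extend_mem _ g.2]
    rw [perm_affine hK a b hb hsurj hb0]
    change _ - _ - _ - ((unitSign (a g) : ℤ) : ℂ) - ((paritySign (b g) : ℤ) : ℂ) =
      if a g = 1 then _ else 0
    rw [stdAddChar_add_stdAddChar_neg]
    have h := congrArg (Int.cast (R := ℂ)) (sum_ite_affine_four (a g) (b g))
    generalize b g = x at *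
    generalize a g = u at *
    push_cast at h ⊢
    rw [h]
    ring
  · simp only [Pi.sub_apply, one_apply, hg, if_false, sgn, F, extend_not_mem _ hg,
      perm_not_mem hK hg, sub_zero]

/-- `K` is a subgroup of index two of `L`. -/
structure IndexTwo (K L : Subgroup G) : Prop where
  lt : K < L
  mul_mem_iff : ∀ x ∈ L, ∀ y ∈ L, x * y ∈ K ↔ (x ∈ K ↔ y ∈ K)

theorem IndexTwo.exists_not_mem {K L : Subgroup G} (h : IndexTwo K L) : ∃ y ∈ L, y ∉ K := by
  by_contra! h'
  exact h.lt.not_ge h'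

theorem IndexTwo.perm_eq {K L : Subgroup G} (h : IndexTwo K L) :
    ∃ δ : L →* ℤˣ, perm K L = one L + sgn L δ := by
  let δ : L →* ℤˣ :=
    { toFun := fun g => if (g : G) ∈ K then 1 else -1
      map_one' := by rw [if_pos (by exact K.one_mem)]
      map_mul' := fun x y => by
        have := h.mul_mem_iff x x.2 y y.2
        rw [Subgroup.coe_mul, this]
        by_cases hx : (x : G) ∈ K <;> by_cases hy : (y : G) ∈ K <;> simp [hx, hy] }
  have hδ : ∀ g, δ g = if (g : G) ∈ K then 1 else -1 := fun _ => rfl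
  refine ⟨δ, ?_⟩
  rw [← perm_ker_sign]
  · congr
    ext g
    constructor
    · intro hg
      exact ⟨⟨g, h.lt.le hg⟩, by simp [hδ, MonoidHom.mem_ker, hg], rfl⟩
    · rintro ⟨x, hx, rfl⟩
      by_contra hx'
      have : (-1 : ℤˣ) = 1 := (if_neg hx').symm.trans hx
      exact absurd this (by decide)
  · intro h1
    obtain ⟨y, hy, hyK⟩ := h.exists_not_mem
    have := DFunLike.congr_fun h1 ⟨y, hy⟩
    rw [hδ, if_neg hyK, MonoidHom.one_apply] at this
    exact absurd this (by decide)

theorem exists_affine_of_indexTwo {K K' L : Subgroup G} (h : IndexTwo K K') (h' : IndexTwo K' L) :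
    ∃ (a : L →* (ZMod 4)ˣ) (b : L → ZMod 4), (∀ g h, b (g * h) = a g * b h + b g) ∧
      Function.Surjective b ∧ ∀ g : L, b g = 0 ↔ (g : G) ∈ K := by
  obtain ⟨y, hy, hyK⟩ := h'.exists_not_mem
  obtain ⟨v, hv, hvK⟩ := h.exists_not_mem
  have hKK' : ∀ g, g ∈ K → g ∈ K' := fun g hg => h.lt.le hg
  lift y to L using hy
  let b : L → ZMod 4 := fun g =>
    if (g : G) ∈ K' then if (g : G) ∈ K then 0 else 2 else if ((y : G)⁻¹ * g) ∈ K then 1 else 3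
  have hb : ∀ g, b g = if (g : G) ∈ K' then if (g : G) ∈ K then 0 else 2
    else if ((y : G)⁻¹ * g) ∈ K then 1 else 3 := fun _ => rfl
  have hyinv : (y : G)⁻¹ ∉ K' := by rwa [inv_mem_iff]
  have hyg : ∀ g : L, (g : G) ∉ K' → ((y : G)⁻¹ * g) ∈ K' := fun g hg => by
    rw [h'.mul_mem_iff _ (L.inv_mem y.2) _ g.2]
    exact iff_of_false hyinv hg
  have hadd : ∀ g k : L, (k : G) ∈ K' → b (g * k) = b g + b k := by
    intro g k hk
    have h1 := h'.mul_mem_iff g g.2 k k.2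
    rw [hb, hb g, hb k, Subgroup.coe_mul, h1, if_pos hk]
    by_cases hg : (g : G) ∈ K'
    · have h2 := h.mul_mem_iff g hg k hk
      rw [h2]
      by_cases hgK : (g : G) ∈ K <;> by_cases hkK : (k : G) ∈ K <;>
        simp only [hg, hk, hgK, hkK, if_true, if_false, iff_true, iff_false, not_true] <;>
          decide
    · have h2 := h.mul_mem_iff _ (hyg g hg) k hk
      rw [← mul_assoc, h2]
      rw [if_neg hg]
      by_cases hgK : ((y : G)⁻¹ * g) ∈ K <;> by_cases hkK : (k : G) ∈ K <;>
        simp only [hg, hk, hgK, hkK, if_true, if_false, iff_true, iff_false, not_true] <;>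
        decide
  have hb1 : b 1 = 0 := by
    rw [hb, if_pos (by exact K'.one_mem), if_pos (by exact K.one_mem)]
  have hby : b y = 1 := by
    rw [hb, if_neg hyK, inv_mul_cancel, if_pos K.one_mem]
  have hbv : ∀ hv', b ⟨v, hv'⟩ = 2 := by
    intro hv'
    rw [hb, if_pos hv, if_neg hvK]
  have heven : ∀ k : L, (k : G) ∈ K' → b k = 0 ∨ b k = 2 := by
    intro k hk
    rw [hb, if_pos hk]
    split_ifs <;> simp
  have hodd : ∀ k : L, (k : G) ∉ K' → b k = 1 ∨ b k = 3 := by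
    intro k hk
    rw [hb, if_neg hk]
    split_ifs <;> simp
  have hpm : ∀ g, b (g * y) - b g = 1 ∨ b (g * y) - b g = 3 := by
    intro g
    have h1 := h'.mul_mem_iff g g.2 y y.2
    by_cases hg : (g : G) ∈ K'
    · have h2 := heven g hg
      have h3 := hodd (g * y) (by simp [h1, hg, hyK])
      generalize b g = s at *
      generalize b (g * y) = t at *
      revert s t
      decide
    · have h2 := hodd g hg
      have h3 := heven (g * y) (by simp [h1, hg, hyK])
      generalize b g = s at *
      generalize b (g * y) = t at *
      revert s t
      decide
  have hcoc : ∀ g k, b (g * k) = (b (g * y) - b g) * b k + b g := by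
    have h1 : ∀ g k : L, (k : G) ∈ K' → (b (g * y) - b g) * b k = b k := by
      intro g k hk
      have h2 := heven k hk
      have h3 := hpm g
      generalize b k = s at *
      generalize b (g * y) - b g = t at *
      revert s t
      decide
    intro g k
    by_cases hk : (k : G) ∈ K'
    · rw [hadd g k hk, h1 g k hk, add_comm]
    · have h2 := hyg k hk
      have h3 := hadd (g * y) (y⁻¹ * k) h2
      have h4 := hadd y (y⁻¹ * k) h2
      have h5 := h1 g (y⁻¹ * k) h2
      rw [mul_inv_cancel_left, hby] at h4
      rw [mul_assoc, mul_inv_cancel_left] at h3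
      rw [h3, h4]
      linear_combination -h5
  refine ⟨MonoidHom.toHomUnits
    { toFun := fun g => b (g * y) - b g
      map_one' := by rw [one_mul, hb1, hby, sub_zero]
      map_mul' := fun g k => by
        rw [mul_assoc, hcoc g (k * y), hcoc g k]
        ring }, b, hcoc, fun i => ?_, fun g => ?_⟩
  · have hvL := h'.lt.le hv
    obtain rfl | rfl | rfl | rfl : i = 0 ∨ i = 1 ∨ i = 2 ∨ i = 3 := by
      revert i
      decide
    · exact ⟨1, hb1⟩
    · exact ⟨y, hby⟩
    · exact ⟨⟨v, hvL⟩, hbv _⟩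
    · refine ⟨y * ⟨v, hvL⟩, ?_⟩
      rw [hadd _ _ hv, hby, hbv]
      rfl
  · constructor
    · intro hg
      by_contra hgK
      rw [hb] at hg
      split_ifs at hg <;> revert hg <;> decide
    · intro hg
      rw [hb, if_pos (hKK' _ hg), if_pos hg]

theorem exists_indexTwo {K H : Subgroup G} (hK : K < H) {c : G} (hc : IsHyper H c) (hcK : c ∈ K) :
    ∃ K' ≤ H, IndexTwo K K' := by
  have : ((Subgroup.zpowers c).subgroupOf H).Normal := by
    refine ⟨fun n hn g => ?_⟩
    rw [Subgroup.mem_subgroupOf] at hn ⊢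
    obtain ⟨j, hj⟩ := exists_conj_eq_zpow hc hn g.2
    change (g * n * (g : G)⁻¹ : G) ∈ _
    rw [hj]
    exact Subgroup.zpow_mem _ hn j
  obtain ⟨C, hC⟩ : ∃ C, C = (Subgroup.zpowers c).subgroupOf H := ⟨_, rfl⟩
  rw [← hC] at this
  have hCK : C ≤ K.subgroupOf H := by
    intro x hx
    rw [hC, Subgroup.mem_subgroupOf] at hx
    exact Subgroup.mem_subgroupOf.2 ((Subgroup.zpowers_le.2 hcK) hx)
  have : Fact (Nat.Prime 2) := ⟨Nat.prime_two⟩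
  have hQ : IsPGroup 2 (H ⧸ C) := by
    intro q
    obtain ⟨g, rfl⟩ := QuotientGroup.mk_surjective q
    obtain ⟨k, hk⟩ := hc.2.2.2 g g.2
    refine ⟨k, ?_⟩
    rw [← QuotientGroup.mk_pow, QuotientGroup.eq_one_iff, hC, Subgroup.mem_subgroupOf]
    exact hk
  let π := QuotientGroup.mk' C
  let A : Subgroup (H ⧸ C) := (K.subgroupOf H).map π
  have hA : A.comap π = K.subgroupOf H := by
    rw [Subgroup.comap_map_eq, QuotientGroup.ker_mk', sup_eq_left]
    exact hCK
  obtain ⟨m, hm⟩ := IsPGroup.iff_card.1 hQ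
  obtain ⟨n, hn⟩ := IsPGroup.iff_card.1 (hQ.to_subgroup A)
  have hAtop : A ≠ ⊤ := by
    intro h
    rw [h, Subgroup.comap_top] at hA
    exact hK.not_ge (Subgroup.subgroupOf_eq_top.1 hA.symm)
  have hlt : n < m := by
    rw [← Nat.pow_lt_pow_iff_right (a := 2) (by norm_num), ← hn, ← hm]
    exact lt_of_le_of_ne (Subgroup.card_le_card_group A) fun h => hAtop (Subgroup.card_eq_iff_eq_top A |>.1 h)
  obtain ⟨B, hB, hAB⟩ := Sylow.exists_subgroup_card_pow_succ (p := 2) (n := n)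
    (by rw [hm]; exact pow_dvd_pow 2 hlt) hn
  have hidx : (A.subgroupOf B).index = 2 := by
    have h := Subgroup.card_mul_index (A.subgroupOf B)
    rw [Nat.card_congr (Subgroup.subgroupOfEquivOfLe hAB).toEquiv, hn, hB, pow_succ] at h
    exact Nat.eq_of_mul_eq_mul_left (by positivity) h
  have hK' : ∀ x : H, (x : G) ∈ K ↔ π x ∈ A := by
    intro x
    rw [← Subgroup.mem_comap, hA, Subgroup.mem_subgroupOf]
  have hL' : ∀ x : H, (x : G) ∈ (B.comap π).map H.subtype ↔ π x ∈ B := by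
    intro x
    rw [← Subgroup.mem_comap]
    exact Subgroup.mem_map_iff_mem H.subtype_injective
  have hLH : (B.comap π).map H.subtype ≤ H := by
    rintro _ ⟨x, _, rfl⟩
    exact x.2
  refine ⟨_, hLH, ⟨lt_of_le_of_ne ?_ ?_, ?_⟩⟩
  · intro x hx
    exact (hL' ⟨x, hK.le hx⟩).2 (hAB ((hK' ⟨x, hK.le hx⟩).1 hx))
  · intro h
    have hBA : B ≤ A := by
      intro q hq
      obtain ⟨g, rfl⟩ := QuotientGroup.mk_surjective q
      exact (hK' g).1 (h ▸ (hL' g).2 hq)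
    have := Subgroup.card_le_of_le hBA
    rw [hn, hB] at this
    exact absurd this (by rw [not_le]; exact Nat.pow_lt_pow_right (by norm_num) (by omega))
  · intro x hx y hy
    have hxB := (hL' ⟨x, hLH hx⟩).1 hx
    have hyB := (hL' ⟨y, hLH hy⟩).1 hy
    have := Subgroup.mul_mem_iff_of_index_two hidx (a := ⟨_, hxB⟩) (b := ⟨_, hyB⟩)
    simp only [Subgroup.mem_subgroupOf, Subgroup.coe_mul, ← map_mul, ← hK'] at this
    exact this

theorem sgn_mul_mem (H : Subgroup G) (a b : H →* ℤˣ) :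
    sgn H a + sgn H b - one H - sgn H (a * b) ∈ genSpan H := by
  by_cases ha : a = 1
  · rw [ha, one_mul, sgn_one, add_sub_cancel_left, sub_self]
    exact zero_mem _
  by_cases hb : b = 1
  · rw [hb, mul_one, sgn_one, add_sub_cancel_right, sub_self]
    exact zero_mem _
  by_cases hab : a = b
  · subst hab
    have haa : a * a = 1 := by
      ext x
      simp
    convert (IsGen.linear (L := H) (((Int.castRingHom ℂ : ℤ →* ℂ).comp
      (Units.coeHom ℤ)).comp a)).mem_genSpan_self using 1
    rw [haa, sgn_one]
    ext g
    by_cases hg : g ∈ H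
    · simp only [Pi.sub_apply, Pi.add_apply, sgn, one, extend_mem _ hg]
      simp
      ring
    · simp [sgn, one, extend_not_mem _ hg]
  · convert (isGen_of_signs a b ha hb hab).mem_genSpan_self using 1
    ext g
    by_cases hg : g ∈ H
    · simp only [Pi.sub_apply, Pi.add_apply, sgn, one, extend_mem _ hg, MonoidHom.mul_apply]
      push_cast
      ring
    · simp [sgn, one, extend_not_mem _ hg]

/-- The functions on `H` congruent to a degree one character modulo the trivial character and
`genSpan H`. -/
def detSpan (H : Subgroup G) : AddSubgroup (G → ℂ) where
  carrier := {f | ∃ (e : ℤ) (δ : H →* ℤˣ), f - e • one H - sgn H δ ∈ genSpan H}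
  zero_mem' := ⟨-1, 1, by rw [sgn_one]; simp [zero_mem]⟩
  add_mem' := by
    rintro f f' ⟨e, δ, h⟩ ⟨e', δ', h'⟩
    refine ⟨e + e' + 1, δ * δ', ?_⟩
    convert add_mem (add_mem h h') (sgn_mul_mem H δ δ') using 1
    simp only [add_smul, one_smul]
    abel
  neg_mem' := by
    rintro f ⟨e, δ, h⟩
    refine ⟨-e - 2, δ, ?_⟩
    have h' := sgn_mul_mem H δ δ
    have hδ : δ * δ = 1 := by
      ext x
      simp
    rw [hδ, sgn_one] at h'
    convert neg_mem (add_mem h h') using 1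
    rw [sub_smul, neg_smul, two_smul]
    abel

theorem genSpan_le_detSpan (H : Subgroup G) : genSpan H ≤ detSpan H := by
  intro f hf
  refine ⟨-1, 1, ?_⟩
  rw [sgn_one]
  simpa using hf

theorem one_mem_detSpan (H : Subgroup G) : one H ∈ detSpan H := by
  refine ⟨0, 1, ?_⟩
  rw [sgn_one]
  simp [zero_mem]

theorem sgn_mem_detSpan (H : Subgroup G) (δ : H →* ℤˣ) : sgn H δ ∈ detSpan H :=
  ⟨0, δ, by simp [zero_mem]⟩

theorem mem_detSpan_of_sub_mem {H : Subgroup G} {f f' : G → ℂ} (h : f - f' ∈ genSpan H)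
    (h' : f' ∈ detSpan H) : f ∈ detSpan H := by
  simpa using add_mem (genSpan_le_detSpan H h) h'

theorem ind_sgn_mem {L H : Subgroup G} (hL : L ≤ H) (P : AddSubgroup (G → ℂ))
    (hP : ∀ M ≤ H, Nat.card L ≤ 2 * Nat.card M → perm M H ∈ P) (δ : L →* ℤˣ) :
    ind L H (sgn L δ) ∈ P := by
  have hPL : perm L H ∈ P := hP L hL (by linarith [Nat.card_pos (α := L)])
  by_cases hδ : δ = 1
  · rw [hδ, sgn_one, ind_one]
    exact hPL
  · have hδ' : sgn L δ = perm (δ.ker.map L.subtype) L - one L := by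
      rw [perm_ker_sign δ hδ, add_sub_cancel_left]
    rw [hδ', map_sub, ind_perm _ hL, ind_one]
    refine sub_mem (hP _ ?_ ?_) hPL
    · rintro _ ⟨x, _, rfl⟩
      exact hL x.2
    · rw [Subgroup.card_map_of_injective L.subtype_injective, ← Subgroup.card_mul_index δ.ker,
        Subgroup.index_ker, mul_comm]
      refine Nat.mul_le_mul_right _ ?_
      refine (Nat.card_le_card_of_injective _ δ.range.subtype_injective).trans ?_
      simp [Nat.card_eq_fintype_card]

theorem IndexTwo.card_eq {K L : Subgroup G} (h : IndexTwo K L) : Nat.card L = 2 * Nat.card K := by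
  obtain ⟨δ, hδ⟩ := h.perm_eq
  have h1 := card_mul_perm_one K L
  have h2 : sgn L δ 1 = 1 := by
    rw [sgn, extend_mem _ L.one_mem]
    exact congrArg (fun u : ℤˣ => ((u : ℤ) : ℂ)) (map_one δ) |>.trans (by simp)
  rw [hδ, Pi.add_apply, one_apply, if_pos L.one_mem, h2, one_add_one_eq_two, mul_comm] at h1
  exact_mod_cast h1.symm

theorem perm_mem_detSpan {H : Subgroup G} {c : G} (hc : IsHyper H c) (K : Subgroup G) (hK : K ≤ H) :
    perm K H ∈ detSpan H := by
  induction hn : Nat.card H - Nat.card K using Nat.strong_induction_on generalizing K with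
  | _ n ih =>
  have ih' : ∀ M ≤ H, Nat.card K < Nat.card M → perm M H ∈ detSpan H := by
    intro M hM hKM
    have := Subgroup.card_le_of_le hM
    exact ih _ (by omega) M hM rfl
  by_cases hcK : c ∈ K
  · rcases hK.eq_or_lt with rfl | hlt
    · rw [perm_self]
      exact one_mem_detSpan K
    obtain ⟨K', hK', hKK'⟩ := exists_indexTwo hlt hc hcK
    rcases hK'.eq_or_lt with rfl | hlt'
    · obtain ⟨δ, hδ⟩ := hKK'.perm_eq
      rw [hδ]
      exact add_mem (one_mem_detSpan _) (sgn_mem_detSpan _ δ)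
    obtain ⟨L, hL, hK'L⟩ := exists_indexTwo hlt' hc (hKK'.lt.le hcK)
    obtain ⟨a, b, hb, hsurj, hb0⟩ := exists_affine_of_indexTwo hKK' hK'L
    obtain ⟨α, β, -, h⟩ := perm_sub_mem_genSpan_of_four (hKK'.lt.le.trans hK'L.lt.le) a b hb hsurj
      hb0
    have h' := ind_mem_genSpan hL h
    have hcard : Nat.card L = 2 * (2 * Nat.card K) := by rw [hK'L.card_eq, hKK'.card_eq]
    have hKpos : 0 < Nat.card K := Nat.card_pos
    have hP : ∀ M ≤ H, Nat.card L ≤ 2 * Nat.card M → perm M H ∈ detSpan H := fun M hM hLM =>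
      ih' M hM (by omega)
    simp only [map_sub, ind_perm _ hL, ind_one] at h'
    rw [sub_sub, sub_sub, sub_sub] at h'
    have hLH := ih' L hL (by omega)
    exact mem_detSpan_of_sub_mem h' (add_mem hLH (add_mem hLH (add_mem (ind_sgn_mem hL _ hP α)
      (ind_sgn_mem hL _ hP β))))
  · obtain ⟨L, hL, hKL, N, hN, hKN, t, h⟩ := exists_sub_mem_genSpan_of_hyper hc hK hcK
    rw [sub_sub] at h
    exact mem_detSpan_of_sub_mem h (add_mem (ih' L hL hKL) (zsmul_mem (ih' N hN hKN) t))

theorem IsGen.apply_one {L : Subgroup G} {f : G → ℂ} (hf : IsGen L f) : f 1 = 0 := by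
  cases hf with
  | linear φ =>
    rw [extend_mem _ L.one_mem]
    change φ 1 + φ 1⁻¹ - 2 = 0
    rw [inv_one, map_one]
    norm_num
  | dihedral n hn Ψ hΨ ψ =>
    rw [extend_mem _ L.one_mem]
    change dih ψ (Ψ 1) = 0
    rw [map_one, DihedralGroup.one_def]
    simp [dih]
    norm_num

theorem apply_one_of_mem_genSpan {H : Subgroup G} {f : G → ℂ} (hf : f ∈ genSpan H) : f 1 = 0 := by
  induction hf using AddSubgroup.closure_induction with
  | mem f hf =>
    obtain ⟨L, hL, f, hf, rfl⟩ := hf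
    rw [ind_apply]
    simp [hf.apply_one]
  | zero => rfl
  | add f g _ _ hf hg => rw [Pi.add_apply, hf, hg, add_zero]
  | neg f _ hf => rw [Pi.neg_apply, hf, neg_zero]

/-- The homomorphism from `ZMod N` given by the powers of an element with trivial `N`-th power. -/
def zmodPow {M : Type*} [Monoid M] (N : ℕ) [NeZero N] (g : M) (hg : g ^ N = 1) :
    Multiplicative (ZMod N) →* M where
  toFun z := g ^ z.toAdd.val
  map_one' := by
    change g ^ (0 : ZMod N).val = 1
    rw [ZMod.val_zero, pow_zero]
  map_mul' x y := by
    rw [toAdd_mul, ZMod.val_add, ← pow_eq_pow_mod _ hg, pow_add]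

theorem EvenOn.sum_range {H : Subgroup G} {f : G → ℂ} (hf : EvenOn H f) {g : G} (hg : g ∈ H)
    {N : ℕ} (hN : 0 < N) (hN2 : Even N) (hgN : g ^ N = 1) :
    ∃ k : ℤ, ∑ j ∈ Finset.range N, (-1) ^ j * f (g ^ j) = N * (2 * k) := by
  have : NeZero N := ⟨hN.ne'⟩
  obtain ⟨k, hk⟩ := hf (Multiplicative (ZMod N)) (zmodPow N g hgN)
    (fun z => H.pow_mem hg _) (zmodPow N (-1) hN2.neg_one_pow)
  refine ⟨k, ?_⟩
  rw [Nat.card_congr Multiplicative.toAdd, Nat.card_zmod] at hk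
  rw [← hk, Finset.sum_range]
  obtain ⟨n, rfl⟩ := Nat.exists_eq_succ_of_ne_zero hN.ne'
  refine Fintype.sum_equiv Multiplicative.ofAdd _ _ fun i => ?_
  change (-1) ^ (i : ℕ) * f (g ^ (i : ℕ)) = ((((-1 : ℤˣ) ^ (i : ℕ) : ℤˣ) : ℤ) : ℂ) * f (g ^ (i : ℕ))
  push_cast
  rfl

theorem mem_genSpan_of_mem_detSpan {H : Subgroup G} {σ : G → ℂ} (h : σ ∈ detSpan H) (h1 : σ 1 = 0)
    (heven : ∀ g ∈ H, ∀ N : ℕ, 0 < N → Even N → g ^ N = 1 →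
      ∃ k : ℤ, ∑ j ∈ Finset.range N, (-1) ^ j * σ (g ^ j) = N * (2 * k)) : σ ∈ genSpan H := by
  obtain ⟨e, δ, hδ⟩ := h
  have hδ1 : δ = 1 := by
    ext g
    by_contra hg
    have hg := (Int.units_eq_one_or (δ g)).resolve_left fun h => hg (by rw [h]; rfl)
    have hN : 0 < 2 * orderOf g := by have := orderOf_pos g; omega
    have hN2 : Even (2 * orderOf g) := even_two_mul _
    have hgN : (g : G) ^ (2 * orderOf g) = 1 := by
      rw [mul_comm, pow_mul, ← Subgroup.orderOf_coe, pow_orderOf_eq_one, one_pow]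
    generalize 2 * orderOf g = N at *
    obtain ⟨k, hk⟩ := heven g g.2 N hN hN2 hgN
    obtain ⟨k', hk'⟩ := (evenOn_of_mem_genSpan hδ).sum_range g.2 hN hN2 hgN
    have h2 : ∀ j, (σ - e • one H - sgn H δ) ((g : G) ^ j) = σ ((g : G) ^ j) - e - (-1) ^ j := by
      intro j
      rw [← Subgroup.coe_pow, Pi.sub_apply, Pi.sub_apply, sgn_coe, Pi.smul_apply, one_apply,
        if_pos (SetLike.coe_mem _), map_pow, hg]
      simp
    have h3 : ∑ j ∈ Finset.range N, (-1 : ℂ) ^ j = 0 := by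
      rw [neg_one_geom_sum, if_pos hN2]
    have h4 : ∀ j : ℕ, (-1 : ℂ) ^ j * (-1) ^ j = 1 := fun j => by
      rw [← mul_pow]
      norm_num
    simp only [h2, mul_sub, Finset.sum_sub_distrib, h4, ← Finset.sum_mul, h3, hk, Finset.sum_const,
      Finset.card_range] at hk'
    have hNC : (N : ℂ) ≠ 0 := Nat.cast_ne_zero.2 hN.ne'
    have h5 : (2 * k - 1 : ℂ) = 2 * k' := by
      apply mul_left_cancel₀ hNC
      rw [← hk', nsmul_eq_mul]
      ring
    have h6 : 2 * k - 1 = 2 * k' := by exact_mod_cast h5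
    omega
  rw [hδ1, sgn_one] at hδ
  have h2 := apply_one_of_mem_genSpan hδ
  rw [Pi.sub_apply, Pi.sub_apply, h1, Pi.smul_apply, one_apply, if_pos H.one_mem] at h2
  have h3 : e = -1 := by
    have : (e : ℂ) = -1 := by
      rw [zsmul_eq_mul, mul_one] at h2
      linear_combination -h2
    exact_mod_cast this
  rw [h3] at hδ
  simpa using hδ

theorem perm_stabilizer {X : Type} [Fintype X] {H : Subgroup G} [MulAction H X] (x : X) (g : H) :
    perm ((MulAction.stabilizer H x).map H.subtype) H g
      = ∑ y : MulAction.orbit H x, if g • (y : X) = y then 1 else 0 := by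
  rw [perm, ind_apply]
  have h1 : ∀ h : H, one ((MulAction.stabilizer H x).map H.subtype) ((h : G)⁻¹ * g * h)
      = if g • (h • x) = h • x then 1 else 0 := by
    intro h
    rw [one_apply]
    refine if_congr ?_ rfl rfl
    have : (h : G)⁻¹ * g * h = H.subtype (h⁻¹ * g * h) := rfl
    rw [this, Subgroup.mem_map_iff_mem H.subtype_injective, MulAction.mem_stabilizer_iff,
      mul_smul, mul_smul, inv_smul_eq_iff]
  rw [Finset.sum_congr rfl fun h _ => h1 h,
    sum_fiber (fun h : H => (⟨h • x, MulAction.mem_orbit x h⟩ : MulAction.orbit H x))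
      (Nat.card (MulAction.stabilizer H x)) ?_
      (fun y => if g • (y : X) = y then (1 : ℂ) else 0),
    Subgroup.card_map_of_injective H.subtype_injective, inv_mul_cancel_left₀]
  · exact card_ne_zero _
  · rintro ⟨_, h₀, rfl⟩
    rw [← Fintype.card_subtype, ← Nat.card_eq_fintype_card]
    refine Nat.card_congr (Equiv.subtypeEquiv (Equiv.mulLeft h₀⁻¹) fun h => ?_)
    rw [MulAction.mem_stabilizer_iff, Equiv.coe_mulLeft, mul_smul, inv_smul_eq_iff]
    exact Subtype.ext_iff

theorem perm_top_apply (K : Subgroup G) (g : G) :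
    perm K ⊤ g = ∑ x : G ⧸ K, if g • x = x then 1 else 0 := by
  rw [← permChar_eq, permChar, Nat.card_eq_fintype_card, Fintype.card_subtype, Finset.card_filter]
  push_cast
  rfl

theorem one_mul_perm_mem (H K : Subgroup G) (P : AddSubgroup (G → ℂ))
    (hP : ∀ S ≤ H, perm S H ∈ P) : one H * perm K ⊤ ∈ P := by
  have h : one H * perm K ⊤ = ∑ ω : Quotient (MulAction.orbitRel H (G ⧸ K)),
      perm ((MulAction.stabilizer H ω.out).map H.subtype) H := by
    ext g
    rw [Finset.sum_apply, Pi.mul_apply, one_apply]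
    by_cases hg : g ∈ H
    · lift g to H using hg
      rw [if_pos g.2, one_mul, perm_top_apply]
      simp only [perm_stabilizer]
      rw [← Fintype.sum_sigma']
      refine Fintype.sum_equiv (MulAction.selfEquivSigmaOrbits H (G ⧸ K)) _ _ fun x => ?_
      congr! 1
    · rw [if_neg hg, zero_mul, Finset.sum_eq_zero]
      intro ω _
      refine perm_not_mem ?_ hg
      rintro _ ⟨x, _, rfl⟩
      exact x.2
  rw [h]
  refine sum_mem fun ω _ => hP _ ?_
  rintro _ ⟨x, _, rfl⟩
  exact x.2

theorem mul_mem_of_mul_perm_mem {f χ : G → ℂ} (hχ : IsPermChar χ) (P : AddSubgroup (G → ℂ))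
    (hP : ∀ K : Subgroup G, f * perm K ⊤ ∈ P) : f * χ ∈ P := by
  obtain ⟨k, K, n, rfl⟩ := hχ
  have h : (f * fun g => ∑ i, (n i : ℂ) * permChar (K i) g) = ∑ i, n i • (f * perm (K i) ⊤) := by
    ext g
    simp only [Pi.mul_apply, Finset.sum_apply, zsmul_eq_mul, Finset.mul_sum, permChar_eq]
    exact Finset.sum_congr rfl fun i _ => by rw [Pi.intCast_apply]; ring
  rw [h]
  exact sum_mem fun i _ => P.zsmul_mem (hP _) _

theorem star_eq_of_isPermChar {χ : G → ℂ} (hχ : IsPermChar χ) (g : G) : star (χ g) = χ g := by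
  obtain ⟨k, K, n, rfl⟩ := hχ
  simp [permChar]

theorem conj_eq_of_isPermChar {χ : G → ℂ} (hχ : IsPermChar χ) (x g : G) :
    χ (x⁻¹ * g * x) = χ g := by
  obtain ⟨k, K, n, rfl⟩ := hχ
  simp only [permChar_eq, perm, ind_conj _ _ _ (Subgroup.mem_top x)]

theorem one_mul_mem_genSpan {H : Subgroup G} {c : G} (hc : IsHyper H c) {χ : G → ℂ}
    (hχ : MemS χ) : one H * χ ∈ genSpan H := by
  obtain ⟨hperm, h1, V, W, hVW, hdet⟩ := hχ
  refine mem_genSpan_of_mem_detSpan (mul_mem_of_mul_perm_mem hperm _ fun K =>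
    one_mul_perm_mem H K _ fun S hS => perm_mem_detSpan hc S hS) (by simp [h1]) ?_
  intro g hg N hN hN2 hgN
  have hreal : ∀ g, star ((V.character - W.character) g) = (V.character - W.character) g := by
    rw [← hVW]; exact star_eq_of_isPermChar hperm
  obtain ⟨k, hk⟩ := even_of_detChar_eq V W hdet hreal g hN hN2 hgN
  refine ⟨k, ?_⟩
  rw [← hk, ← hVW]
  refine Finset.sum_congr rfl fun j _ => ?_
  rw [Pi.mul_apply, one_apply, if_pos (H.pow_mem hg j), one_mul]

theorem IsHyper.exists_of_le {H S : Subgroup G} {c : G} (hc : IsHyper H c) (hS : S ≤ H) :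
    ∃ c', IsHyper S c' := by
  obtain ⟨hcH, hodd, hnorm, hpow⟩ := hc
  obtain ⟨c', hc'⟩ := (Subgroup.isCyclic_iff_exists_zpowers_eq_top (Subgroup.zpowers c ⊓ S)).1
    (isCyclic_of_injective (Subgroup.inclusion (inf_le_left : Subgroup.zpowers c ⊓ S ≤ _))
      (Subgroup.inclusion_injective _))
  have hmem : c' ∈ Subgroup.zpowers c ⊓ S := hc' ▸ Subgroup.mem_zpowers c'
  refine ⟨c', hmem.2, ?_, ?_, ?_⟩
  · exact hodd.of_dvd_nat (orderOf_dvd_of_mem_zpowers hmem.1)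
  · intro h hh
    rw [hc']
    refine ⟨?_, S.mul_mem (S.mul_mem hh hmem.2) (S.inv_mem hh)⟩
    obtain ⟨i, rfl⟩ := hmem.1
    change h * c ^ i * h⁻¹ ∈ _
    rw [← conj_zpow]
    exact zpow_mem (hnorm h (hS hh)) i
  · intro h hh
    obtain ⟨k, hk⟩ := hpow h (hS hh)
    exact ⟨k, hc' ▸ ⟨hk, S.pow_mem hh _⟩⟩

variable (G) in
/-- The group generated by the permutation characters on cosets of the subgroups `H` that have
a normal cyclic subgroup of odd order with `2`-group quotient. -/
def hyperSpan : AddSubgroup (G → ℂ) :=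
  AddSubgroup.closure {f | ∃ (H : Subgroup G) (c : G), IsHyper H c ∧ f = perm H ⊤}

theorem perm_mul (H : Subgroup G) {χ : G → ℂ} (hχ : ∀ x g, χ (x⁻¹ * g * x) = χ g) :
    perm H ⊤ * χ = ind H ⊤ (one H * χ) := by
  rw [ind_mul H ⊤ _ fun x _ => hχ x, ind_one]

theorem mul_mem_hyperSpan {f f' : G → ℂ} (hf : f ∈ hyperSpan G) (hf' : f' ∈ hyperSpan G) :
    f * f' ∈ hyperSpan G := by
  induction hf using AddSubgroup.closure_induction with
  | zero => rw [zero_mul]; exact zero_mem _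
  | add x y _ _ hx hy => rw [add_mul]; exact add_mem hx hy
  | neg x _ hx => rw [neg_mul]; exact neg_mem hx
  | mem x hx =>
    obtain ⟨H, c, hc, rfl⟩ := hx
    induction hf' using AddSubgroup.closure_induction with
    | zero => rw [mul_zero]; exact zero_mem _
    | add x y _ _ hx hy => rw [mul_add]; exact add_mem hx hy
    | neg x _ hx => rw [mul_neg]; exact neg_mem hx
    | mem x hx =>
      obtain ⟨K, -, -, rfl⟩ := hx
      rw [perm_mul H (χ := perm K ⊤) fun x g => ind_conj K ⊤ _ (Subgroup.mem_top x) g]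
      refine one_mul_perm_mem H K ((hyperSpan G).comap (ind H ⊤).toAddMonoidHom) fun S hS => ?_
      obtain ⟨c', hc'⟩ := hc.exists_of_le hS
      change ind H ⊤ (perm S H) ∈ hyperSpan G
      rw [ind_perm S le_top]
      exact AddSubgroup.subset_closure ⟨S, c', hc', rfl⟩

theorem mul_mem_genSpan {f χ : G → ℂ} (hf : f ∈ hyperSpan G) (hχ : MemS χ) :
    f * χ ∈ genSpan ⊤ := by
  induction hf using AddSubgroup.closure_induction with
  | zero => rw [zero_mul]; exact zero_mem _
  | add x y _ _ hx hy => rw [add_mul]; exact add_mem hx hy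
  | neg x _ hx => rw [neg_mul]; exact neg_mem hx
  | mem x hx =>
    obtain ⟨H, c, hc, rfl⟩ := hx
    rw [perm_mul H (conj_eq_of_isPermChar hχ.1)]
    exact ind_mem_genSpan le_top (one_mul_mem_genSpan hc hχ)

theorem exists_isHyper_of_normal (g : G) (a : ℕ) (hodd : Odd (orderOf (g ^ 2 ^ a)))
    (hn : (Subgroup.zpowers (g ^ 2 ^ a)).Normal) :
    ∃ H : Subgroup G, IsHyper H (g ^ 2 ^ a) ∧ ∃ k : ℕ, Odd k ∧ perm H ⊤ g = k := by
  obtain ⟨S⟩ : Nonempty (Sylow 2 G) := inferInstance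
  set c := g ^ 2 ^ a with hcg
  set C := Subgroup.zpowers c with hC
  have hcH : c ∈ C ⊔ (S : Subgroup G) :=
    (le_sup_left : C ≤ C ⊔ (S : Subgroup G)) (Subgroup.mem_zpowers c)
  refine ⟨C ⊔ (S : Subgroup G), ⟨hcH, hodd, fun h _ => hn.conj_mem _ (Subgroup.mem_zpowers c) h,
    fun h hh => ?_⟩, ?_⟩
  · obtain ⟨y, hy, z, hz, rfl⟩ := Subgroup.mem_sup_of_normal_left.1 hh
    obtain ⟨k, hk⟩ := S.isPGroup' ⟨z, hz⟩
    have hk' : z ^ 2 ^ k = 1 := congrArg Subtype.val hk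
    refine ⟨k, (QuotientGroup.eq_one_iff _).1 ?_⟩
    rw [QuotientGroup.mk_pow, QuotientGroup.mk_mul, (QuotientGroup.eq_one_iff y).2 hy, one_mul,
      ← QuotientGroup.mk_pow, hk', QuotientGroup.mk_one]
  · refine ⟨Nat.card {x : G ⧸ (C ⊔ (S : Subgroup G)) // g • x = x}, ?_,
      (congrFun (permChar_eq _) g).symm⟩
    have hindex : Odd (C ⊔ (S : Subgroup G)).index := by
      rw [← Nat.not_even_iff_odd, even_iff_two_dvd]
      exact fun h => S.not_dvd_index (h.trans (Subgroup.index_dvd_of_le le_sup_right))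
    generalize C ⊔ (S : Subgroup G) = H at hcH hindex
    have hpow : (MulAction.toEndHom g : Function.End (G ⧸ H)) ^ 2 ^ a = 1 := by
      rw [← map_pow, ← hcg]
      funext x
      obtain ⟨x, rfl⟩ := QuotientGroup.mk_surjective x
      change ((c * x : G) : G ⧸ H) = x
      rw [eq_comm, QuotientGroup.eq, ← mul_assoc]
      have h := hn.conj_mem _ (Subgroup.mem_zpowers c) x⁻¹
      rw [inv_inv] at h
      exact Subgroup.zpowers_le.2 hcH h
    have h := Equiv.Perm.card_fixedPoints_modEq (p := 2) hpow
    rw [← Nat.card_eq_fintype_card, @Fintype.card_eq_nat_card _ (_)] at h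
    rw [Nat.odd_iff] at hindex ⊢
    exact (Eq.symm h).trans hindex

theorem zpowers_conj_eq {c x : G} (hodd : Odd (orderOf c)) {k : ℕ}
    (h : (x⁻¹ * c * x) ^ 2 ^ k ∈ Subgroup.zpowers c) :
    x ∈ Subgroup.normalizer (Subgroup.zpowers c : Set G) := by
  have hord : orderOf (x⁻¹ * c * x) = orderOf c := by
    simpa using MulEquiv.orderOf_eq (MulAut.conj x⁻¹) c
  have hmem : x⁻¹ * c * x ∈ Subgroup.zpowers c := by
    obtain ⟨m, hm⟩ := exists_pow_eq_self_of_coprime (x := x⁻¹ * c * x) (n := 2 ^ k)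
      (by rw [hord]; exact hodd.coprime_two_left.pow_left k)
    rw [← hm]
    exact pow_mem h m
  have heq : Subgroup.zpowers (x⁻¹ * c * x) = Subgroup.zpowers c :=
    Subgroup.eq_of_le_of_card_ge (by simpa using hmem) (by
      rw [Nat.card_zpowers, Nat.card_zpowers, hord])
  rw [Subgroup.mem_normalizer_iff'']
  intro h
  have hconj : ∀ i : ℤ, (x⁻¹ * c * x) ^ i = x⁻¹ * c ^ i * x := fun i => by
    simpa using conj_zpow (a := x⁻¹) (b := c) (i := i)
  constructor
  · rintro ⟨i, rfl⟩
    rw [← heq]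
    exact ⟨i, hconj i⟩
  · intro hh
    rw [← heq] at hh
    obtain ⟨i, hi⟩ := hh
    change (x⁻¹ * c * x) ^ i = _ at hi
    rw [hconj, mul_left_inj, mul_right_inj] at hi
    exact ⟨i, hi⟩

theorem exists_isHyper (g : G) :
    ∃ (H : Subgroup G) (c : G), IsHyper H c ∧ ∃ k : ℕ, Odd k ∧ perm H ⊤ g = k := by
  obtain ⟨a, m, hm, ham⟩ := Nat.exists_eq_two_pow_mul_odd (orderOf_pos g).ne'
  have hord : orderOf (g ^ 2 ^ a) = m := by
    rw [orderOf_pow_of_dvd (by positivity) ⟨m, ham⟩, ham, Nat.mul_div_cancel_left _ (by positivity)]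
  set c := g ^ 2 ^ a with hc
  have hgN : g ∈ Subgroup.normalizer (Subgroup.zpowers c : Set G) :=
    zpowers_conj_eq (k := 0) (hord ▸ hm) (by
      rw [pow_zero, pow_one, hc, mul_assoc, pow_mul_comm', inv_mul_cancel_left]
      exact Subgroup.mem_zpowers _)
  set N := Subgroup.normalizer (Subgroup.zpowers c : Set G) with hN
  obtain ⟨H, hH, k, hk, hkH⟩ := exists_isHyper_of_normal (⟨g, hgN⟩ : N) a
    (by rw [← Subgroup.orderOf_coe]; exact hord ▸ hm) (by
      constructor
      rintro _ ⟨i, rfl⟩ n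
      obtain ⟨j, hj⟩ := (Subgroup.mem_normalizer_iff.1 n.2 (c ^ i)).1 ⟨i, rfl⟩
      exact ⟨j, Subtype.ext hj⟩)
  have hH' : IsHyper (H.map N.subtype) c := by
    obtain ⟨h1, -, h3, h4⟩ := hH
    refine ⟨⟨_, h1, rfl⟩, hord ▸ hm, ?_, ?_⟩
    · rintro _ ⟨h, hh, rfl⟩
      obtain ⟨j, hj⟩ := h3 h hh
      exact ⟨j, congrArg Subtype.val hj⟩
    · rintro _ ⟨h, hh, rfl⟩
      obtain ⟨k, j, hj⟩ := h4 h hh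
      exact ⟨k, j, congrArg Subtype.val hj⟩
  refine ⟨H.map N.subtype, c, hH', k, hk, ?_⟩
  rw [← hkH, perm, perm, ind_top, ind_top, Subgroup.card_map_of_injective N.subtype_injective]
  congr 1
  symm
  refine Fintype.sum_of_injective N.subtype N.subtype_injective _ _ ?_ ?_
  · intro x hx
    rw [one_apply, if_neg]
    intro hmem
    obtain ⟨k, hk⟩ := hH'.2.2.2 _ (pow_mem hmem (2 ^ a))
    refine hx ⟨⟨x, zpowers_conj_eq (k := k) (hord ▸ hm) ?_⟩, rfl⟩
    have : (x⁻¹ * g * x) ^ 2 ^ a = x⁻¹ * c * x := by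
      simpa using conj_pow (a := x⁻¹) (b := g) (i := 2 ^ a)
    rwa [← this]
  · intro x
    rw [one_apply, one_apply]
    refine if_congr ?_ rfl rfl
    exact (Subgroup.mem_map_iff_mem N.subtype_injective).symm

theorem exists_odd_on (s : Finset G) :
    ∃ f ∈ hyperSpan G, ∃ m : ℤ, Odd m ∧ ∀ g ∈ s, f g = m := by
  induction s using Finset.induction_on with
  | empty => exact ⟨0, zero_mem _, 1, odd_one, by simp⟩
  | insert g s _ ih =>
    obtain ⟨f, hf, m, hm, hfm⟩ := ih
    obtain ⟨H, c, hH, k, hk, hkH⟩ := exists_isHyper g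
    have hp : perm H ⊤ ∈ hyperSpan G := AddSubgroup.subset_closure ⟨H, c, hH, rfl⟩
    refine ⟨m • perm H ⊤ + (k : ℤ) • f - f * perm H ⊤,
      sub_mem (add_mem (zsmul_mem hp _) (zsmul_mem hf _)) (mul_mem_hyperSpan hf hp),
      m * k, hm.mul (by exact_mod_cast hk), fun x hx => ?_⟩
    rw [Pi.sub_apply, Pi.add_apply, Pi.smul_apply, Pi.smul_apply, Pi.mul_apply, zsmul_eq_mul,
      zsmul_eq_mul]
    push_cast
    rcases Finset.mem_insert.1 hx with rfl | hx
    · rw [hkH]; ring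
    · rw [hfm x hx]; ring

theorem exists_odd_zsmul_mem_genSpan {χ : G → ℂ} (hχ : MemS χ) :
    ∃ m : ℤ, Odd m ∧ m • χ ∈ genSpan (⊤ : Subgroup G) := by
  obtain ⟨f, hf, m, hm, hfm⟩ := exists_odd_on (Finset.univ : Finset G)
  refine ⟨m, hm, ?_⟩
  convert mul_mem_genSpan hf hχ using 1
  ext g
  rw [Pi.smul_apply, zsmul_eq_mul, Pi.mul_apply, hfm g (Finset.mem_univ g)]

end PermInd

end

/-- Let `P` be a set of real-valued characters of `G` such that
(1) `τ + τ̄ ∈ P` for every (virtual) character `τ` of degree `0`;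
(2) `Ind_H^G (τ - 1 - det τ) ∈ P` for every subgroup `H ≤ G` and every degree `2`
character `τ` of `H` that factors through a quotient of `H` isomorphic to `C₂ × C₂`,
`D₈`, or `D_{2p}` for an odd prime `p`;
(3) `P` is closed under `ℤ`-linear combinations.
Then `P` contains every permutation character of `G` of degree `0` with trivial
determinant. -/
theorem induction_theorem_for_permutation_characters
    (G : Type) [Group G] [Finite G] (P : Set (G → ℂ))
    (hreal : ∀ χ ∈ P, ∀ g : G, star (χ g) = χ g)
    (h1 : ∀ V W : FDRep ℂ G, V.character 1 = W.character 1 →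
      ((V.character - W.character) + star (V.character - W.character)) ∈ P)
    (h2 : ∀ (H : Subgroup G) (τ : FDRep ℂ ↥H), τ.character 1 = 2 →
      ∀ (N : Subgroup ↥H) [N.Normal],
        (∀ n h : ↥H, n ∈ N → τ.character (n * h) = τ.character h) →
        (Nonempty (↥H ⧸ N ≃* Multiplicative (ZMod 2) × Multiplicative (ZMod 2)) ∨
         Nonempty (↥H ⧸ N ≃* DihedralGroup 4) ∨
         ∃ p : ℕ, p.Prime ∧ Odd p ∧ Nonempty (↥H ⧸ N ≃* DihedralGroup p)) →
        indChar H (τ.character - 1 - detChar τ) ∈ P)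
    (h3 : ∀ (k : ℕ) (τs : Fin k → (G → ℂ)) (ns : Fin k → ℤ),
      (∀ i, τs i ∈ P) → (∑ i, ns i • τs i) ∈ P) :
    ∀ χ : G → ℂ, MemS χ → χ ∈ P := by
  intro χ hχ
  let _ : Fintype G := Fintype.ofFinite G
  have hadd : ∀ a b : ℤ, ∀ x ∈ P, ∀ y ∈ P, a • x + b • y ∈ P := fun a b x hx y hy => by
    simpa using h3 2 ![x, y] ![a, b] (by simp [Fin.forall_fin_two, hx, hy])
  let Q : AddSubgroup (G → ℂ) :=
    { carrier := P
      zero_mem' := by simpa using h3 0 Fin.elim0 Fin.elim0 fun i => i.elim0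
      add_mem' := fun {x y} hx hy => by simpa using hadd 1 1 x hx y hy
      neg_mem' := fun {x} hx => by simpa using hadd (-1) 0 x hx x hx }
  have htwo : (2 : ℤ) • χ ∈ Q := by
    obtain ⟨hperm, hone, V, W, hVW, -⟩ := hχ
    have h := h1 V W (sub_eq_zero.1 (by rw [← Pi.sub_apply, ← hVW, hone]))
    have hstar : star χ = χ := funext (PermInd.star_eq_of_isPermChar hperm)
    rw [← hVW, hstar] at h
    rw [two_zsmul]
    exact h
  obtain ⟨m, ⟨k, hk⟩, hm⟩ := PermInd.exists_odd_zsmul_mem_genSpan hχ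
  have hχm : χ = m • χ - k • ((2 : ℤ) • χ) := by
    rw [← mul_smul, ← sub_smul, hk, show 2 * k + 1 - k * 2 = 1 by ring, one_smul]
  have hmem : χ ∈ Q := by
    rw [hχm]
    exact sub_mem (PermInd.genSpan_top_le Q h1 h2 hm) (zsmul_mem htwo k)
  exact hmem
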